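/- arXiv:2101.06026 — 6 statements merged into one kernel-verified Lean document; each statement's English description precedes it below -/
import Mathlib

section
/- For all integers n ≥ 0 and 0 ≤ k ≤ n, the number of 132-avoiding permutations in A(n,k) equals the ballot number C_{n,k} = ((n−k+1)/(n+1))·binom(n+k, k); that is, #A_{n,k}(132) = C_{n,k}. -/
attribute [local instance] Classical.propDecidable

/-- The maximum drop size of a permutation (0-indexed positions and values). -/
def maxdrop {n : ℕ} (π : Equiv.Perm (Fin n)) : ℕ :=
  Finset.univ.sup fun i : Fin n => (i : ℕ) - (π i : ℕ)

/-- `A(n,k)`: permutations of `[n]` with maximum drop size at most `k`. -/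
def bddA (n k : ℕ) : Finset (Equiv.Perm (Fin n)) :=
  Finset.univ.filter fun π => maxdrop π ≤ k

/-- `S(n,k)`: permutations of `[n]` with `σ i - i ≤ k` for all `i`. -/
def bddS (n k : ℕ) : Finset (Equiv.Perm (Fin n)) :=
  Finset.univ.filter fun π => ∀ i : Fin n, (π i : ℕ) ≤ (i : ℕ) + k

/-- The number of inversions of a permutation. -/
def invStat {n : ℕ} (π : Equiv.Perm (Fin n)) : ℕ :=
  (Finset.univ.filter fun p : Fin n × Fin n => p.1 < p.2 ∧ π p.2 < π p.1).card

/-- The number of left-to-right maxima of a permutation. -/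
def lmaxStat {n : ℕ} (π : Equiv.Perm (Fin n)) : ℕ :=
  (Finset.univ.filter fun i : Fin n => ∀ j, j < i → π j < π i).card

/-- The number of cycles of a permutation, fixed points included. -/
def cycStat {n : ℕ} (π : Equiv.Perm (Fin n)) : ℕ :=
  π.cycleType.card + (Finset.univ.filter fun i => π i = i).card

/-- The sorting index: `σ` has a unique factorization
`σ = (i₁,j₁)(i₂,j₂)⋯(iₘ,jₘ)` into transpositions with `j₁ < j₂ < ⋯ < jₘ` and
`iᵣ < jᵣ` for all `r`, and `sor σ = Σᵣ (jᵣ - iᵣ)`. -/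
noncomputable def sorStat {n : ℕ} (σ : Equiv.Perm (Fin n)) : ℕ :=
  if h : ∃ l : List (Fin n × Fin n),
      (∀ p ∈ l, p.1 < p.2) ∧ l.Chain' (fun p q => p.2 < q.2) ∧
      σ = (l.map fun p => Equiv.swap p.1 p.2).prod
  then (h.choose.map fun p => (p.2 : ℕ) - (p.1 : ℕ)).sum
  else 0

/-- `DIS σ = sor σ⁻¹`. -/
noncomputable def DIS {n : ℕ} (σ : Equiv.Perm (Fin n)) : ℕ := sorStat σ⁻¹

/-- 213-avoiding permutations: no `i < j < l` with `π j < π i < π l`. -/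
def avoids213 {n : ℕ} (π : Equiv.Perm (Fin n)) : Prop :=
  ¬ ∃ i j l : Fin n, i < j ∧ j < l ∧ π j < π i ∧ π i < π l

/-- 132-avoiding permutations: no `i < j < l` with `π i < π l < π j`. -/
def avoids132 {n : ℕ} (π : Equiv.Perm (Fin n)) : Prop :=
  ¬ ∃ i j l : Fin n, i < j ∧ j < l ∧ π i < π l ∧ π l < π j

/-- 321-avoiding permutations: no `i < j < l` with `π i > π j > π l`. -/
def avoids321 {n : ℕ} (π : Equiv.Perm (Fin n)) : Prop :=
  ¬ ∃ i j l : Fin n, i < j ∧ j < l ∧ π l < π j ∧ π j < π i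

/-- The number of descents of a permutation. -/
def desStat {n : ℕ} (π : Equiv.Perm (Fin n)) : ℕ :=
  (Finset.univ.filter fun i : Fin n =>
    ∃ j : Fin n, (j : ℕ) = (i : ℕ) + 1 ∧ π j < π i).card

/-- The number of right-to-left maxima of a permutation. -/
def rmaxStat {n : ℕ} (π : Equiv.Perm (Fin n)) : ℕ :=
  (Finset.univ.filter fun i : Fin n => ∀ j, i < j → π j < π i).card

/-- The number of non-weak excedances before the last position. -/
def vnwStat {N : ℕ} (π : Equiv.Perm (Fin N)) : ℕ :=
  (Finset.univ.filter fun i : Fin N => (i : ℕ) + 1 < N ∧ (π i : ℕ) < (i : ℕ)).card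

/-- `Γ_{n,k}`: sequences of `n` ones (`true`) and `k` negative ones (`false`)
with all partial sums nonnegative. -/
noncomputable def GammaBP (n k : ℕ) : Finset (Fin (n + k) → Bool) :=
  Finset.univ.filter fun a =>
    (Finset.univ.filter fun i => a i = true).card = n ∧
    ∀ m ∈ Finset.range (n + k + 1),
      (Finset.univ.filter fun i : Fin (n + k) => (i : ℕ) < m ∧ a i = false).card ≤
      (Finset.univ.filter fun i : Fin (n + k) => (i : ℕ) < m ∧ a i = true).card

/-- `vpk a`: the number of ones immediately followed by a `-1` that are not the
rightmost one. -/
def vpkStat {N : ℕ} (a : Fin N → Bool) : ℕ :=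
  (Finset.univ.filter fun i : Fin N =>
    a i = true ∧ (∃ j : Fin N, (j : ℕ) = (i : ℕ) + 1 ∧ a j = false) ∧
    ∃ j : Fin N, i < j ∧ a j = true).card

/-- `Γ^u_{n,k}`: elements of `Γ_{n,k}` ending with a one. -/
noncomputable def GammaBPU (n k : ℕ) : Finset (Fin (n + k) → Bool) :=
  (GammaBP n k).filter fun a => ∀ i : Fin (n + k), (i : ℕ) + 1 = n + k → a i = true

/-- `Γ^d_{n,k}`: elements of `Γ_{n,k}` ending with a negative one. -/
noncomputable def GammaBPD (n k : ℕ) : Finset (Fin (n + k) → Bool) :=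
  (GammaBP n k).filter fun a => ∀ i : Fin (n + k), (i : ℕ) + 1 = n + k → a i = false

/-- The transposition `t_{i,j}` of `1`-based positions `i` and `j`. -/
def transp (n i j : ℕ) : Equiv.Perm (Fin n) :=
  if h : i - 1 < n ∧ j - 1 < n then Equiv.swap ⟨i - 1, h.1⟩ ⟨j - 1, h.2⟩ else 1

/-- `Ψ_{i,k} = 1 + sᵢ + sᵢsᵢ₋₁ + ⋯` (with `min i k + 1` terms) in `ℤ[Sₙ]`,
where `sᵢ = (i, i+1)` (1-based). -/
noncomputable def PsiElt (n k i : ℕ) : MonoidAlgebra ℤ (Equiv.Perm (Fin n)) :=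
  ∑ m ∈ Finset.range (min i k + 1),
    MonoidAlgebra.of ℤ (Equiv.Perm (Fin n))
      (((List.range m).map fun r => transp n (i - r) (i - r + 1)).prod)

/-- `Φ_{i,k} = 1 + t_{i,i+1} + t_{i-1,i+1} + ⋯` (with `min i k + 1` terms)
in `ℤ[Sₙ]`. -/
noncomputable def PhiElt (n k i : ℕ) : MonoidAlgebra ℤ (Equiv.Perm (Fin n)) :=
  ∑ m ∈ Finset.range (min i k + 1),
    MonoidAlgebra.of ℤ (Equiv.Perm (Fin n)) (transp n (i + 1 - m) (i + 1))

/-- `[i]_q = 1 + q + ⋯ + q^{i-1}` as an element of `ℤ[q,t]`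
(with `q = X 0`, `t = X 1`). -/
noncomputable def qBracket (i : ℕ) : MvPolynomial (Fin 2) ℤ :=
  ∑ j ∈ Finset.range i, MvPolynomial.X 0 ^ j

/-- Insert a first value `p`. -/
def insP {n : ℕ} (p : Fin (n + 1)) (σ : Equiv.Perm (Fin n)) : Equiv.Perm (Fin (n + 1)) :=
  (finSuccEquiv n).trans ((Equiv.optionCongr σ).trans (finSuccEquiv' p).symm)

lemma insP_zero {n : ℕ} (p : Fin (n + 1)) (σ : Equiv.Perm (Fin n)) : insP p σ 0 = p := by
  simp [insP]

lemma insP_succ {n : ℕ} (p : Fin (n + 1)) (σ : Equiv.Perm (Fin n)) (i : Fin n) :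
    insP p σ i.succ = p.succAbove (σ i) := by
  simp [insP]

lemma insP_bij (n : ℕ) : Function.Bijective
    (fun x : Fin (n + 1) × Equiv.Perm (Fin n) => insP x.1 x.2) := by
  rw [Fintype.bijective_iff_injective_and_card]
  constructor
  · rintro ⟨p, σ⟩ ⟨q, τ⟩ h
    simp only at h
    have h0 : p = q := by rw [← insP_zero p σ, h, insP_zero]
    subst h0
    have h1 : σ = τ := by
      ext i
      have : insP p σ i.succ = insP p τ i.succ := by rw [h]
      rw [insP_succ, insP_succ] at this
      rw [Fin.succAbove_right_injective this]
    rw [h1]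
  · simp [Fintype.card_perm, Nat.factorial_succ]

lemma insP_avoids {n : ℕ} (p : Fin (n + 1)) (σ : Equiv.Perm (Fin n)) :
    avoids132 (insP p σ) ↔ avoids132 σ ∧ ∀ i : Fin n, (i : ℕ) = 0 → (σ i : ℕ) ≤ p := by
  constructor
  · intro h
    refine ⟨?_, ?_⟩
    · rintro ⟨i, j, l, h1, h2, h3, h4⟩
      refine h ⟨i.succ, j.succ, l.succ, by simpa, by simpa, ?_, ?_⟩
      · rw [insP_succ, insP_succ]; simpa using h3
      · rw [insP_succ, insP_succ]; simpa using h4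
    · intro i hi
      by_contra! hlt
      have hpn : (p : ℕ) < n := hlt.trans (σ i).2
      set l : Fin n := σ.symm ⟨p, hpn⟩ with hl
      have hσl : σ l = ⟨p, hpn⟩ := by simp [hl]
      have hil : i < l := by
        rcases lt_trichotomy i l with h' | h' | h'
        · exact h'
        · rw [h', hσl] at hlt; simp at hlt
        · rw [Fin.lt_def] at h'; omega
      refine h ⟨0, i.succ, l.succ, Fin.succ_pos i, by simpa, ?_, ?_⟩
      · rw [insP_zero, insP_succ, hσl, Fin.lt_succAbove_iff_le_castSucc]
        simp [Fin.le_def]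
      · rw [insP_succ, insP_succ, Fin.succAbove_lt_succAbove_iff, hσl]
        exact hlt
  · rintro ⟨h, h0⟩ ⟨i, j, l, h1, h2, h3, h4⟩
    obtain ⟨j, rfl⟩ := Fin.exists_succ_eq.2 (Fin.pos_iff_ne_zero.1 ((Fin.zero_le i).trans_lt h1))
    obtain ⟨l, rfl⟩ := Fin.exists_succ_eq.2
      (Fin.pos_iff_ne_zero.1 ((Fin.zero_le _).trans_lt h2))
    rw [insP_succ, insP_succ, Fin.succAbove_lt_succAbove_iff] at h4
    rw [Fin.succ_lt_succ_iff] at h2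
    rcases Fin.eq_zero_or_eq_succ i with rfl | ⟨i, rfl⟩
    · rw [insP_zero, insP_succ, Fin.lt_succAbove_iff_le_castSucc] at h3
      have hn : 0 < n := j.pos
      have hz := h0 ⟨0, hn⟩ rfl
      have h3' : (p : ℕ) ≤ σ l := by simpa [Fin.le_def] using h3
      have hle : σ ⟨0, hn⟩ ≤ σ l := by rw [Fin.le_def]; omega
      have hlt : σ ⟨0, hn⟩ < σ l := by
        refine lt_of_le_of_ne hle fun e => ?_
        have := σ.injective e
        rw [← this, Fin.lt_def] at h2
        simp at h2
      refine h ⟨⟨0, hn⟩, j, l, ?_, h2, hlt, h4⟩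
      rw [Fin.lt_def]
      refine Nat.pos_of_ne_zero fun e => ?_
      have : j = ⟨0, hn⟩ := Fin.ext e
      subst this
      exact absurd (hlt.trans h4) (lt_irrefl _)
    · rw [insP_succ, insP_succ, Fin.succAbove_lt_succAbove_iff] at h3
      rw [Fin.succ_lt_succ_iff] at h1
      exact h ⟨i, j, l, h1, h2, h3, h4⟩

/-- 132-avoiding permutations whose first value is at most `k`. -/
noncomputable def GG (n k : ℕ) : Finset (Equiv.Perm (Fin n)) :=
  Finset.univ.filter fun σ => avoids132 σ ∧ ∀ i : Fin n, (i : ℕ) = 0 → (σ i : ℕ) ≤ k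

lemma card_first {n : ℕ} (p : Fin (n + 1)) :
    (Finset.univ.filter fun σ : Equiv.Perm (Fin (n + 1)) => avoids132 σ ∧ σ 0 = p).card
      = (GG n p).card := by
  symm
  refine Finset.card_bij (fun σ _ => insP p σ) ?_ ?_ ?_
  · intro σ hσ
    simp only [GG, Finset.mem_filter, Finset.mem_univ, true_and] at hσ ⊢
    exact ⟨(insP_avoids p σ).2 hσ, insP_zero p σ⟩
  · intro σ _ τ _ h
    have := (insP_bij n).1 (a₁ := (p, σ)) (a₂ := (p, τ)) h
    exact (Prod.ext_iff.1 this).2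
  · intro τ hτ
    simp only [Finset.mem_filter, Finset.mem_univ, true_and] at hτ
    obtain ⟨⟨q, σ⟩, h⟩ := (insP_bij n).2 τ
    simp only at h
    subst h
    obtain ⟨h1, h2⟩ := hτ
    rw [insP_zero] at h2
    subst h2
    refine ⟨σ, ?_, rfl⟩
    simp only [GG, Finset.mem_filter, Finset.mem_univ, true_and]
    exact (insP_avoids q σ).1 h1

lemma mem_GG_succ {n k : ℕ} (σ : Equiv.Perm (Fin (n + 1))) :
    σ ∈ GG (n + 1) k ↔ avoids132 σ ∧ (σ 0 : ℕ) ≤ k := by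
  simp only [GG, Finset.mem_filter, Finset.mem_univ, true_and]
  refine and_congr_right fun _ => ⟨fun h => h 0 rfl, fun h i hi => ?_⟩
  have : i = 0 := Fin.ext hi
  rwa [this]

lemma GG_zero_right (n : ℕ) : (GG (n + 1) 0).card = (GG n 0).card := by
  have := card_first (n := n) 0
  rw [Fin.val_zero] at this
  rw [← this]
  congr 1
  ext σ
  rw [mem_GG_succ]
  simp only [Finset.mem_filter, Finset.mem_univ, true_and]
  refine and_congr_right fun _ => ?_
  rw [Fin.ext_iff, Fin.val_zero]
  omega

lemma GG_last (n : ℕ) : (GG (n + 1) (n + 1)).card = (GG (n + 1) n).card := by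
  congr 1
  ext σ
  rw [mem_GG_succ, mem_GG_succ]
  have := (σ 0).2
  refine and_congr_right fun _ => ⟨fun h => by omega, fun h => by omega⟩

lemma GG_step (n k : ℕ) (hk : k + 1 ≤ n) :
    (GG (n + 1) (k + 1)).card = (GG (n + 1) k).card + (GG n (k + 1)).card := by
  have := card_first (n := n) ⟨k + 1, by omega⟩
  simp only at this
  rw [← this, ← Finset.card_union_of_disjoint]
  · congr 1
    ext σ
    rw [Finset.mem_union, mem_GG_succ, mem_GG_succ]
    simp only [Finset.mem_filter, Finset.mem_univ, true_and, Fin.ext_iff]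
    rw [← and_or_left]
    refine and_congr_right fun _ => ?_
    omega
  · rw [Finset.disjoint_left]
    intro σ h1 h2
    rw [mem_GG_succ] at h1
    simp only [Finset.mem_filter, Finset.mem_univ, true_and, Fin.ext_iff] at h2
    omega

lemma ballot_step (n k : ℕ) :
    ((n : ℚ) + 1 - ((k : ℚ) + 1) + 1) / ((n : ℚ) + 1 + 1) * ((n + 1 + (k + 1)).choose (k + 1) : ℚ)
     = ((n : ℚ) + 1 - k + 1) / ((n : ℚ) + 1 + 1) * ((n + 1 + k).choose k : ℚ)
      + ((n : ℚ) - ((k : ℚ) + 1) + 1) / ((n : ℚ) + 1) * ((n + (k + 1)).choose (k + 1) : ℚ) := by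
  have e1 : (n + 1 + (k + 1)).choose (k + 1) = (n + k + 1).choose k + (n + k + 1).choose (k + 1) := by
    rw [show n + 1 + (k + 1) = (n + k + 1) + 1 by ring, Nat.choose_succ_succ]
  have e2 : ((n + k + 1).choose (k + 1) : ℚ) * (k + 1) = (n + k + 1).choose k * (n + 1) := by
    have := Nat.choose_succ_right_eq (n + k + 1) k
    rw [show n + k + 1 - k = n + 1 by omega] at this
    exact_mod_cast this
  rw [e1, show n + 1 + k = n + k + 1 by ring, show n + (k + 1) = n + k + 1 by ring]
  push_cast
  have h1 : (n : ℚ) + 1 ≠ 0 := by positivity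
  have h2 : (n : ℚ) + 1 + 1 ≠ 0 := by positivity
  have h3 : (k : ℚ) + 1 ≠ 0 := by positivity
  have e3 : ((n + k + 1).choose (k + 1) : ℚ) = (n + k + 1).choose k * (n + 1) / (k + 1) := by
    field_simp; linarith
  rw [e3]
  field_simp
  ring

lemma GG_card (n : ℕ) : ∀ k, k ≤ n → ((GG n k).card : ℚ) =
      ((n : ℚ) - (k : ℚ) + 1) / ((n : ℚ) + 1) * ((n + k).choose k : ℚ) := by
  induction n with
  | zero =>
    intro k hk
    obtain rfl : k = 0 := by omega
    have : GG 0 0 = Finset.univ := by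
      ext σ
      simp only [GG, Finset.mem_filter, Finset.mem_univ, true_and, iff_true]
      exact ⟨fun ⟨i, _⟩ => i.elim0, fun i => i.elim0⟩
    rw [this]
    simp
  | succ n ih =>
    intro k
    induction k with
    | zero =>
      intro _
      rw [GG_zero_right, ih 0 (by omega)]
      have h1 : (n : ℚ) + 1 ≠ 0 := by positivity
      have h2 : (n : ℚ) + 1 + 1 ≠ 0 := by positivity
      simp [h1, h2]
    | succ k ihk =>
      intro hk
      have := ballot_step n k
      rcases Nat.lt_or_ge n (k + 1) with h | h
      · obtain rfl : k = n := by omega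
        rw [GG_last, ihk (by omega)]
        push_cast
        rw [this]
        simp
      · rw [GG_step n k h]
        push_cast
        rw [ihk (by omega), ih (k + 1) h]
        push_cast
        exact this.symm

lemma avoids132_inv {n : ℕ} {π : Equiv.Perm (Fin n)} (h : avoids132 π) : avoids132 π⁻¹ := by
  rintro ⟨i, j, l, h1, h2, h3, h4⟩
  exact h ⟨π⁻¹ i, π⁻¹ l, π⁻¹ j, h3, h4, by simpa using h1, by simpa using h2⟩

lemma exc_le {n : ℕ} (σ : Equiv.Perm (Fin n)) (h : avoids132 σ) (z : Fin n) (hz : (z : ℕ) = 0)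
    (j : Fin n) : (σ j : ℕ) ≤ j + σ z := by
  by_contra! hlt
  have hzj : z < j := by
    rw [Fin.lt_def]
    refine Nat.pos_of_ne_zero (fun e => ?_) |>.trans_le' (le_of_eq hz)
    have : j = z := Fin.ext (by omega)
    subst this; omega
  have hsub : (Finset.Ioo (σ z) (σ j)).image σ.symm ⊆ Finset.Ioo z j := by
    intro x hx
    simp only [Finset.mem_image, Finset.mem_Ioo] at hx ⊢
    obtain ⟨y, ⟨hy1, hy2⟩, rfl⟩ := hx
    constructor
    · rw [Fin.lt_def, hz]
      refine Nat.pos_of_ne_zero fun e => ?_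
      have : σ.symm y = z := Fin.ext (by omega)
      rw [← this] at hy1
      simp at hy1
    · rcases lt_trichotomy (σ.symm y) j with h' | h' | h'
      · exact h'
      · rw [← h'] at hy2; simp at hy2
      · exact absurd ⟨z, j, σ.symm y, hzj, h', by simpa using hy1, by simpa using hy2⟩ h
  have := Finset.card_le_card hsub
  rw [Finset.card_image_of_injective _ σ.symm.injective, Fin.card_Ioo, Fin.card_Ioo] at this
  rw [Fin.lt_def] at hzj
  omega

lemma maxdrop_iff {n k : ℕ} (π : Equiv.Perm (Fin n)) (h : avoids132 π) :
    maxdrop π ≤ k ↔ ∀ i : Fin n, (i : ℕ) = 0 → (π⁻¹ i : ℕ) ≤ k := by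
  unfold maxdrop
  rw [Finset.sup_le_iff]
  constructor
  · intro H i hi
    have := H (π⁻¹ i) (Finset.mem_univ _)
    have e : π (π⁻¹ i) = i := π.apply_symm_apply i
    rw [e] at this
    omega
  · intro H i _
    have hn := i.pos
    have h1 := exc_le π⁻¹ (avoids132_inv h) ⟨0, hn⟩ rfl (π i)
    have h2 := H ⟨0, hn⟩ rfl
    have e : π⁻¹ (π i) = i := π.symm_apply_apply i
    rw [e] at h1
    omega

/-- `#A_{n,k}(132) = C_{n,k} = ((n-k+1)/(n+1))·binom(n+k,k)`. -/
theorem stmt10 (n k : ℕ) (hk : k ≤ n) :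
    (((bddA n k).filter fun π => avoids132 π).card : ℚ) =
      ((n : ℚ) - (k : ℚ) + 1) / ((n : ℚ) + 1) * ((n + k).choose k : ℚ) := by
  rw [← GG_card n k hk]
  congr 1
  refine Finset.card_bij (fun π _ => π⁻¹) ?_ ?_ ?_
  · intro π hπ
    simp only [bddA, GG, Finset.mem_filter, Finset.mem_univ, true_and] at hπ ⊢
    exact ⟨avoids132_inv hπ.2, (maxdrop_iff π hπ.2).1 hπ.1⟩
  · intro π _ τ _ h
    exact inv_injective h
  · intro σ hσ
    simp only [bddA, GG, Finset.mem_filter, Finset.mem_univ, true_and] at hσ ⊢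
    have ha := avoids132_inv hσ.1
    refine ⟨σ⁻¹, ⟨(maxdrop_iff _ ha).2 ?_, ha⟩, inv_inv σ⟩
    rw [inv_inv]
    exact hσ.2
end

section
/- For all integers n ≥ 0 and 0 ≤ k ≤ n, the number of 321-avoiding permutations of [n+1] whose last entry equals k+1 is the ballot number C_{n,k} = ((n−k+1)/(n+1))·binom(n+k, k); that is, #S_{n+1}^k(321) = C_{n,k}. -/
attribute [local instance] Classical.propDecidable

/-- Values `≥ k` appear in increasing order. -/
def incFrom {n : ℕ} (k : ℕ) (σ : Equiv.Perm (Fin n)) : Prop :=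
  ∀ i j : Fin n, i < j → k ≤ (σ j : ℕ) → ¬ σ j < σ i

/-- Append the last value `p`, standardizing the rest. -/
def appendLast {n : ℕ} (p : Fin (n + 1)) (σ : Equiv.Perm (Fin n)) :
    Equiv.Perm (Fin (n + 1)) :=
  (finSuccEquiv' (Fin.last n)).trans ((Equiv.optionCongr σ).trans (finSuccEquiv' p).symm)

lemma appendLast_last {n : ℕ} (p : Fin (n + 1)) (σ : Equiv.Perm (Fin n)) :
    appendLast p σ (Fin.last n) = p := by
  simp [appendLast]

lemma appendLast_castSucc {n : ℕ} (p : Fin (n + 1)) (σ : Equiv.Perm (Fin n)) (i : Fin n) :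
    appendLast p σ i.castSucc = p.succAbove (σ i) := by
  have h : finSuccEquiv' (Fin.last n) i.castSucc = some i := by
    rw [← Fin.succAbove_last_apply]
    exact finSuccEquiv'_succAbove _ _
  simp [appendLast, h]

lemma appendLast_bijective (n : ℕ) :
    Function.Bijective (fun x : Fin (n + 1) × Equiv.Perm (Fin n) => appendLast x.1 x.2) := by
  rw [Fintype.bijective_iff_injective_and_card]
  constructor
  · rintro ⟨p, σ⟩ ⟨q, τ⟩ h
    simp only at h
    have hp : p = q := by
      rw [← appendLast_last p σ, h, appendLast_last]
    subst hp
    have : σ = τ := by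
      ext1 i
      have := congrArg (fun e => e i.castSucc) h
      simp only [appendLast_castSucc] at this
      exact Fin.succAbove_right_injective this
    rw [this]
  · simp [Fintype.card_perm, Nat.factorial_succ]

lemma card_filter_append (n : ℕ) (P : Equiv.Perm (Fin (n + 1)) → Prop)
    [DecidablePred P] :
    (Finset.univ.filter P).card =
      ∑ p : Fin (n + 1), (Finset.univ.filter fun σ => P (appendLast p σ)).card := by
  simp only [Finset.card_filter]
  rw [← Fintype.sum_prod_type' (f := fun p σ => if P (appendLast p σ) then 1 else 0)]
  exact ((appendLast_bijective n).sum_comp (fun π => if P π then 1 else 0)).symm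

lemma lt_succAbove_val {n : ℕ} (p : Fin (n + 1)) (x : Fin n) :
    p < p.succAbove x ↔ (p : ℕ) ≤ (x : ℕ) := by
  rw [Fin.lt_succAbove_iff_le_castSucc]
  simp [Fin.le_def]

lemma avoids_append {n : ℕ} (p : Fin (n + 1)) (σ : Equiv.Perm (Fin n)) :
    avoids321 (appendLast p σ) ↔ avoids321 σ ∧ incFrom (p : ℕ) σ := by
  constructor
  · intro h
    refine ⟨?_, ?_⟩
    · rintro ⟨i, j, l, hij, hjl, h1, h2⟩
      exact h ⟨i.castSucc, j.castSucc, l.castSucc, by simpa, by simpa,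
        by simpa [appendLast_castSucc], by simpa [appendLast_castSucc]⟩
    · intro i j hij hp hlt
      refine h ⟨i.castSucc, j.castSucc, Fin.last n, by simpa, Fin.castSucc_lt_last j, ?_,
        by simpa [appendLast_castSucc]⟩
      rw [appendLast_last, appendLast_castSucc, lt_succAbove_val]
      exact hp
  · rintro ⟨h, hi⟩ ⟨i, j, l, hij, hjl, h1, h2⟩
    induction j using Fin.lastCases with
    | last => exact absurd hjl (not_lt.2 (Fin.le_last l))
    | cast j =>
    induction i using Fin.lastCases with
    | last => exact absurd hij (not_lt.2 (Fin.le_last _))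
    | cast i =>
    rw [appendLast_castSucc, appendLast_castSucc, Fin.succAbove_lt_succAbove_iff] at h2
    induction l using Fin.lastCases with
    | last =>
      rw [appendLast_last, appendLast_castSucc, lt_succAbove_val] at h1
      exact hi i j (by simpa using hij) h1 h2
    | cast l =>
      rw [appendLast_castSucc, appendLast_castSucc, Fin.succAbove_lt_succAbove_iff] at h1
      exact h ⟨i, j, l, by simpa using hij, by simpa using hjl, h1, h2⟩

lemma incFrom_of_le {n k : ℕ} (h : n ≤ k + 1) (σ : Equiv.Perm (Fin n)) : incFrom k σ := by
  intro i j _ hk hlt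
  have := (σ i).isLt
  have : (σ j : ℕ) < σ i := hlt
  omega

/-- 321-avoiding permutations whose values `≥ k` increase. -/
noncomputable def gCount (n k : ℕ) : ℕ :=
  (Finset.univ.filter fun σ : Equiv.Perm (Fin n) => avoids321 σ ∧ incFrom k σ).card

lemma inc_append_lt {n k : ℕ} (p : Fin (n + 1)) (hp : (p : ℕ) < k) (σ : Equiv.Perm (Fin n))
    (hs : incFrom (p : ℕ) σ) : incFrom k (appendLast p σ) := by
  intro i j hij hk hlt
  induction i using Fin.lastCases with
  | last => exact absurd hij (not_lt.2 (Fin.le_last _))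
  | cast i =>
  induction j using Fin.lastCases with
  | last => rw [appendLast_last] at hk; omega
  | cast j =>
  rw [appendLast_castSucc, appendLast_castSucc, Fin.succAbove_lt_succAbove_iff] at hlt
  rw [appendLast_castSucc] at hk
  exact hs i j (by simpa using hij)
    ((lt_succAbove_val p _).1 (Fin.lt_def.2 (by omega))) hlt

lemma inc_append_mid {n k : ℕ} (p : Fin (n + 1)) (hp : k ≤ (p : ℕ)) (hn : (p : ℕ) < n)
    (σ : Equiv.Perm (Fin n)) : ¬ incFrom k (appendLast p σ) := by
  intro h
  refine h (σ.symm ⟨p, hn⟩).castSucc (Fin.last n) (Fin.castSucc_lt_last _) ?_ ?_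
  · rwa [appendLast_last]
  · rw [appendLast_last, appendLast_castSucc, lt_succAbove_val]
    simp

lemma inc_append_last {n k : ℕ} (σ : Equiv.Perm (Fin n)) :
    incFrom k (appendLast (Fin.last n) σ) ↔ incFrom k σ := by
  constructor
  · intro h i j hij hk hlt
    exact h i.castSucc j.castSucc (by simpa) (by simpa [appendLast_castSucc])
      (by simpa [appendLast_castSucc])
  · intro h i j hij hk hlt
    induction i using Fin.lastCases with
    | last => exact absurd hij (not_lt.2 (Fin.le_last _))
    | cast i =>
    induction j using Fin.lastCases with
    | last =>
      rw [appendLast_last] at hlt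
      exact absurd hlt (not_lt.2 (Fin.le_last _))
    | cast j =>
      simp only [appendLast_castSucc, Fin.succAbove_last, Fin.castSucc_lt_castSucc_iff,
        Fin.val_castSucc] at hlt hk hij
      exact h i j hij hk hlt

lemma gCount_inner (n k : ℕ) (p : Fin (n + 1)) :
    (Finset.univ.filter fun σ : Equiv.Perm (Fin n) =>
      avoids321 (appendLast p σ) ∧ incFrom k (appendLast p σ)).card =
    if (p : ℕ) < k then gCount n p else if (p : ℕ) < n then 0 else gCount n k := by
  split_ifs with h1 h2
  · refine congrArg Finset.card (Finset.filter_congr fun σ _ => ?_)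
    rw [avoids_append]
    exact ⟨fun h => h.1, fun h => ⟨h, inc_append_lt p h1 σ h.2⟩⟩
  · rw [Finset.card_eq_zero, Finset.filter_eq_empty_iff]
    intro σ _ h
    exact inc_append_mid p (by omega) h2 σ h.2
  · obtain rfl : p = Fin.last n := Fin.ext (by simp; omega)
    refine congrArg Finset.card (Finset.filter_congr fun σ _ => ?_)
    rw [avoids_append, inc_append_last]
    exact ⟨fun h => ⟨h.1.1, h.2⟩, fun h => ⟨⟨h.1, incFrom_of_le (by simp) σ⟩, h.2⟩⟩

lemma gCount_succ (n k : ℕ) (hk : k ≤ n) :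
    gCount (n + 1) k = ∑ j ∈ Finset.range (k + 1), gCount n j := by
  rw [gCount, card_filter_append]
  simp only [gCount_inner]
  rw [Fin.sum_univ_eq_sum_range
    (fun p => if p < k then gCount n p else if p < n then 0 else gCount n k) (n + 1),
    Finset.sum_range_succ, Finset.sum_range_succ, if_neg (by omega), if_neg (by omega)]
  congr 1
  rw [← Finset.sum_subset (Finset.range_mono hk)]
  · exact Finset.sum_congr rfl fun x hx => if_pos (Finset.mem_range.1 hx)
  · intro x hx hx'
    simp only [Finset.mem_range] at hx hx'
    rw [if_neg hx', if_pos hx]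

lemma gCount_top (n : ℕ) : gCount (n + 1) (n + 1) = gCount (n + 1) n := by
  refine congrArg Finset.card (Finset.filter_congr fun σ _ => ?_)
  simp [incFrom_of_le]

/-- The ballot number. -/
def ballot (n k : ℕ) : ℚ :=
  ((n : ℚ) - (k : ℚ) + 1) / ((n : ℚ) + 1) * ((n + k).choose k : ℚ)

lemma ballot_rec (n k : ℕ) : ballot (n + 1) (k + 1) = ballot (n + 1) k + ballot n (k + 1) := by
  have h1 : (n + 1 + (k + 1)).choose (k + 1) = (n + k + 1).choose k + (n + k + 1).choose (k + 1) := by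
    rw [show n + 1 + (k + 1) = (n + k + 1) + 1 by ring, Nat.choose_succ_succ']
  have h2 : (n + k + 1).choose (k + 1) * (k + 1) = (n + k + 1).choose k * (n + 1) := by
    rw [Nat.choose_succ_right_eq]
    congr 1
    omega
  have h2' : ((n + k + 1).choose (k + 1) : ℚ) * (k + 1) = (n + k + 1).choose k * (n + 1) := by
    exact_mod_cast h2
  unfold ballot
  rw [h1, show n + 1 + k = n + k + 1 by ring, show n + (k + 1) = n + k + 1 by ring]
  push_cast
  have e1 : (n : ℚ) + 1 ≠ 0 := by positivity
  have e2 : (n : ℚ) + 1 + 1 ≠ 0 := by positivity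
  field_simp
  linear_combination h2'

lemma ballot_sum (n k : ℕ) : ∑ j ∈ Finset.range (k + 1), ballot n j = ballot (n + 1) k := by
  induction k with
  | zero =>
    have e1 : (n : ℚ) + 1 ≠ 0 := by positivity
    have e2 : (n : ℚ) + 1 + 1 ≠ 0 := by positivity
    simp [ballot, e1, e2]
  | succ k ih => rw [Finset.sum_range_succ, ih, ballot_rec]

lemma gCount_eq (n : ℕ) : ∀ k ≤ n, (gCount n k : ℚ) = ballot n k := by
  induction n with
  | zero =>
    intro k hk
    obtain rfl : k = 0 := by omega
    have : gCount 0 0 = 1 := by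
      rw [gCount, Finset.filter_true_of_mem]
      · simp
      · intro σ _
        exact ⟨fun ⟨i, _⟩ => i.elim0, fun i => i.elim0⟩
    simp [this, ballot]
  | succ n ih =>
    have key : ∀ k ≤ n, (gCount (n + 1) k : ℚ) = ballot (n + 1) k := by
      intro k hk
      rw [gCount_succ n k hk, ← ballot_sum]
      push_cast
      refine Finset.sum_congr rfl fun j hj => ih j ?_
      have := Finset.mem_range.1 hj
      omega
    intro k hk
    rcases Nat.lt_or_ge n k with h | h
    · obtain rfl : k = n + 1 := by omega
      rw [gCount_top, key n le_rfl, ballot_rec]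
      simp [ballot]
    · exact key k h


/-- `#S_{n+1}^k(321) = C_{n,k}`; the last (1-based) entry being
`k+1` reads `(π ⟨n,_⟩ : ℕ) = k` in 0-based terms. -/
theorem stmt11 (n k : ℕ) (hk : k ≤ n) :
    (((Finset.univ.filter fun π : Equiv.Perm (Fin (n + 1)) =>
        avoids321 π ∧ (π ⟨n, Nat.lt_succ_self n⟩ : ℕ) = k)).card : ℚ) =
      ((n : ℚ) - (k : ℚ) + 1) / ((n : ℚ) + 1) * ((n + k).choose k : ℚ) := by
  refine Eq.trans ?_ (gCount_eq n k hk)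
  congr 1
  rw [card_filter_append, Finset.sum_eq_single (⟨k, by omega⟩ : Fin (n + 1))]
  · refine congrArg Finset.card (Finset.filter_congr fun σ _ => ?_)
    have := appendLast_last (⟨k, by omega⟩ : Fin (n + 1)) σ
    rw [avoids_append]
    constructor
    · exact fun h => h.1
    · exact fun h => ⟨h, congrArg Fin.val this⟩
  · intro p _ hp
    rw [Finset.card_eq_zero, Finset.filter_eq_empty_iff]
    rintro σ _ ⟨_, h⟩
    exact hp (Fin.ext ((congrArg Fin.val (appendLast_last p σ)).symm.trans h))
  · simp
end

section
/- For all integers n ≥ 3 and 1 ≤ k ≤ n−2, the number of 321-avoiding permutations π of [n] with last entry π_n = k+1 and π^{-1}(k) > k equals the ballot number C_{n−2,k}. -/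
attribute [local instance] Classical.propDecidable

/-- 321-avoiders of `Fin m` whose values `≥ k` appear in increasing order. -/
def InB (m k : ℕ) (τ : Equiv.Perm (Fin m)) : Prop :=
  avoids321 τ ∧ ∀ i j : Fin m, i < j → k ≤ (τ i : ℕ) → k ≤ (τ j : ℕ) → (τ i : ℕ) < (τ j : ℕ)

noncomputable def BB (m k : ℕ) : Finset (Equiv.Perm (Fin m)) :=
  Finset.univ.filter fun τ => InB m k τ

noncomputable def WW (m k : ℕ) : Finset (Equiv.Perm (Fin m)) :=
  BB m (k + 1) \ BB m k

/-- Append a last entry `j`, shifting the values `≥ j`. -/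
def App {m : ℕ} (j : Fin (m + 1)) (τ : Equiv.Perm (Fin m)) : Equiv.Perm (Fin (m + 1)) :=
  ((finSuccEquiv' (Fin.last m)).trans τ.optionCongr).trans (finSuccEquiv' j).symm

theorem App_last {m : ℕ} (j : Fin (m + 1)) (τ : Equiv.Perm (Fin m)) :
    App j τ (Fin.last m) = j := by
  simp [App]

theorem App_castSucc {m : ℕ} (j : Fin (m + 1)) (τ : Equiv.Perm (Fin m)) (i : Fin m) :
    App j τ i.castSucc = j.succAbove (τ i) := by
  simp [App, finSuccEquiv'_last_apply_castSucc]

theorem App_val {m : ℕ} (j : Fin (m + 1)) (τ : Equiv.Perm (Fin m)) (i : Fin m) :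
    (App j τ i.castSucc : ℕ) = if (τ i : ℕ) < j then (τ i : ℕ) else (τ i : ℕ) + 1 := by
  rw [App_castSucc]
  simp only [Fin.succAbove, Fin.lt_def, Fin.val_castSucc]
  split_ifs <;> simp

theorem App_inj {m : ℕ} (j : Fin (m + 1)) : Function.Injective (App j) := by
  intro τ τ' h
  ext i : 1
  have := congrArg (fun f => f i.castSucc) h
  simpa [App_castSucc] using this

theorem App_surj {m : ℕ} (σ : Equiv.Perm (Fin (m + 1))) :
    ∃ τ, σ = App (σ (Fin.last m)) τ := by
  set e : Option (Fin m) ≃ Option (Fin m) :=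
    ((finSuccEquiv' (Fin.last m)).symm.trans σ).trans (finSuccEquiv' (σ (Fin.last m))) with he
  have hn : e none = none := by simp [he]
  refine ⟨Equiv.removeNone e, ?_⟩
  ext i : 1
  induction i using Fin.lastCases with
  | last => rw [App_last]
  | cast i =>
    have h1 : some (Equiv.removeNone e i) = e (some i) := by
      apply Equiv.removeNone_some
      have : e (some i) ≠ none := by
        rw [← hn]; intro h; simpa using e.injective h
      exact Option.ne_none_iff_exists'.mp this
    have h2 : (finSuccEquiv' (σ (Fin.last m))).symm (e (some i)) = σ i.castSucc := by
      simp [he]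
    rw [← h2, ← h1, App_castSucc]
    simp

theorem avoids_App {m : ℕ} (j : Fin (m + 1)) (τ : Equiv.Perm (Fin m)) :
    avoids321 (App j τ) ↔ InB m j τ := by
  constructor
  · intro h
    refine ⟨?_, ?_⟩
    · rintro ⟨a, b, c, hab, hbc, h1, h2⟩
      refine h ⟨a.castSucc, b.castSucc, c.castSucc, hab, hbc, ?_, ?_⟩ <;>
      · rw [Fin.lt_def, App_val, App_val]
        rw [Fin.lt_def] at h1 h2
        split_ifs <;> omega
    · intro a b hab ha hb
      by_contra hc
      have hne : (τ a : ℕ) ≠ τ b := fun hh => hab.ne (τ.injective (Fin.ext hh))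
      refine h ⟨a.castSucc, b.castSucc, Fin.last m, hab, Fin.castSucc_lt_last b, ?_, ?_⟩
      · rw [Fin.lt_def, App_val, App_last]; split_ifs <;> omega
      · rw [Fin.lt_def, App_val, App_val]; split_ifs <;> omega
  · rintro ⟨h1, h2⟩ ⟨a, b, c, hab, hbc, h3, h4⟩
    have hbl : b ≠ Fin.last m := (lt_of_lt_of_le hbc (Fin.le_last c)).ne
    have hal : a ≠ Fin.last m := (lt_of_lt_of_le hab (Fin.le_last b)).ne
    obtain ⟨b, rfl⟩ := Fin.exists_castSucc_eq.mpr hbl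
    obtain ⟨a, rfl⟩ := Fin.exists_castSucc_eq.mpr hal
    rw [Fin.castSucc_lt_castSucc_iff] at hab
    have hab2 := h2 a b hab
    rw [Fin.lt_def] at h3 h4
    rw [App_val, App_val] at h4
    by_cases hc : c = Fin.last m
    · subst hc
      rw [App_val, App_last] at h3
      split_ifs at h3 h4 <;> omega
    · obtain ⟨c, rfl⟩ := Fin.exists_castSucc_eq.mpr hc
      rw [App_val, App_val] at h3
      rw [Fin.castSucc_lt_castSucc_iff] at hbc
      refine h1 ⟨a, b, c, hab, hbc, ?_, ?_⟩ <;> rw [Fin.lt_def] <;>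
        split_ifs at h3 h4 <;> omega

theorem InB_App {m : ℕ} (k : ℕ) (j : Fin (m + 1)) (τ : Equiv.Perm (Fin m)) :
    InB (m + 1) k (App j τ) ↔ InB m j τ ∧
      (∀ a b : Fin m, a < b → k ≤ (App j τ a.castSucc : ℕ) → k ≤ (App j τ b.castSucc : ℕ) →
        (App j τ a.castSucc : ℕ) < App j τ b.castSucc) ∧
      (∀ a : Fin m, k ≤ (App j τ a.castSucc : ℕ) → k ≤ (j : ℕ) →
        (App j τ a.castSucc : ℕ) < j) := by
  unfold InB
  rw [avoids_App]
  constructor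
  · rintro ⟨h, h2⟩
    refine ⟨h, fun a b hab => h2 _ _ hab, fun a h3 h4 => ?_⟩
    have := h2 a.castSucc (Fin.last m) (Fin.castSucc_lt_last a) h3
    rw [App_last] at this
    exact this h4
  · rintro ⟨h, h2, h3⟩
    refine ⟨h, fun a b hab h4 h5 => ?_⟩
    have hal : a ≠ Fin.last m := (lt_of_lt_of_le hab (Fin.le_last b)).ne
    obtain ⟨a, rfl⟩ := Fin.exists_castSucc_eq.mpr hal
    by_cases hc : b = Fin.last m
    · subst hc
      rw [App_last] at h5 ⊢
      exact h3 a h4 h5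
    · obtain ⟨c, rfl⟩ := Fin.exists_castSucc_eq.mpr hc
      exact h2 a c hab h4 h5

theorem InB_mono {m k l : ℕ} (h : k ≤ l) (τ : Equiv.Perm (Fin m)) (hτ : InB m k τ) :
    InB m l τ :=
  ⟨hτ.1, fun i j hij h1 h2 => hτ.2 i j hij (h.trans h1) (h.trans h2)⟩

/-- Appending the maximum. -/
theorem InB_App_last {m : ℕ} (k : ℕ) (τ : Equiv.Perm (Fin m)) :
    InB (m + 1) k (App (Fin.last m) τ) ↔ InB m k τ := by
  have hv : ∀ a, (App (Fin.last m) τ a.castSucc : ℕ) = τ a := by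
    intro a; rw [App_val, if_pos (by simp)]
  rw [InB_App]
  simp only [hv]
  constructor
  · rintro ⟨h1, h2, -⟩
    exact ⟨h1.1, h2⟩
  · rintro ⟨h1, h2⟩
    refine ⟨⟨h1, ?_⟩, h2, ?_⟩
    · intro i j _ h
      have := (τ i).isLt
      simp at h; omega
    · intro a _ _
      simp

/-- Appending something else: the values `≥ k` are in order when `j < k`. -/
theorem InB_App_lt {m : ℕ} (k : ℕ) (j : Fin (m + 1)) (hj : (j : ℕ) < k)
    (τ : Equiv.Perm (Fin m)) :
    InB (m + 1) k (App j τ) ↔ InB m j τ := by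
  rw [InB_App]
  refine ⟨fun h => h.1, fun h => ⟨h, ?_, fun a _ h5 => by omega⟩⟩
  intro a b hab
  have := h.2 a b hab
  rw [App_val, App_val]
  split_ifs <;> omega

theorem not_InB_App {m : ℕ} (k : ℕ) (j : Fin (m + 1)) (hj : k ≤ (j : ℕ)) (hl : (j : ℕ) < m)
    (τ : Equiv.Perm (Fin m)) : ¬ InB (m + 1) k (App j τ) := by
  rw [InB_App]
  rintro ⟨-, -, h⟩
  have h1 := h (τ⁻¹ ⟨m - 1, by omega⟩)
  rw [App_val] at h1
  simp at h1
  split_ifs at h1 <;> omega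

theorem mem_BB {m k : ℕ} {τ : Equiv.Perm (Fin m)} : τ ∈ BB m k ↔ InB m k τ := by
  simp [BB]

theorem BB_subset (m k : ℕ) : BB m k ⊆ BB m (k + 1) := fun τ h =>
  mem_BB.mpr (InB_mono (Nat.le_succ k) τ (mem_BB.mp h))

theorem WW_eq (m k : ℕ) (hk : k < m) :
    WW (m + 1) k = (WW m k).image (App (Fin.last m)) ∪
      (BB m k).image (App ⟨k, by omega⟩) := by
  ext σ
  simp only [WW, Finset.mem_union, Finset.mem_image, Finset.mem_sdiff, mem_BB]
  constructor
  · rintro ⟨h1, h2⟩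
    obtain ⟨τ, hτ⟩ := App_surj σ
    set j := σ (Fin.last m) with hj
    rw [hτ] at h1 h2
    by_cases hjl : j = Fin.last m
    · left
      rw [hjl] at h1 h2 hτ
      rw [InB_App_last] at h1 h2
      exact ⟨τ, ⟨h1, h2⟩, hτ.symm⟩
    · have hjm : (j : ℕ) < m := Fin.val_lt_last hjl
      right
      have hjk : (j : ℕ) = k := by
        rcases lt_trichotomy (j : ℕ) k with h | h | h
        · rw [InB_App_lt _ _ (by omega)] at h1 h2
          exact absurd h1 h2
        · exact h
        · exact absurd h1 (not_InB_App _ _ (by omega) hjm τ)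
      have hjk' : (⟨k, by omega⟩ : Fin (m + 1)) = j := Fin.ext hjk.symm
      rw [InB_App_lt _ _ (by omega), hjk] at h1
      exact ⟨τ, h1, by rw [hjk']; exact hτ.symm⟩
  · rintro (⟨τ, ⟨h1, h2⟩, rfl⟩ | ⟨τ, h1, rfl⟩)
    · rw [InB_App_last, InB_App_last]; exact ⟨h1, h2⟩
    · refine ⟨?_, not_InB_App _ _ le_rfl hk τ⟩
      rw [InB_App_lt _ _ (by simp)]
      exact h1

theorem card_WW_add (m k : ℕ) : (WW m k).card + (BB m k).card = (BB m (k + 1)).card :=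
  Finset.card_sdiff_add_card_eq_card (BB_subset m k)

theorem card_WW (m k : ℕ) (hk : k < m) : (WW (m + 1) k).card = (BB m (k + 1)).card := by
  rw [WW_eq m k hk, Finset.card_union_of_disjoint, Finset.card_image_of_injective _ (App_inj _),
    Finset.card_image_of_injective _ (App_inj _), card_WW_add]
  rw [Finset.disjoint_left]
  intro σ h1 h2
  obtain ⟨τ, -, rfl⟩ := Finset.mem_image.mp h1
  obtain ⟨τ', -, h⟩ := Finset.mem_image.mp h2
  have := congrArg (fun f => f (Fin.last m)) h
  simp only [App_last] at this
  have := congrArg Fin.val this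
  simp at this
  omega

theorem card_BB_zero (m : ℕ) : (BB m 0).card = 1 := by
  rw [Finset.card_eq_one]
  refine ⟨1, ?_⟩
  ext τ
  rw [mem_BB, Finset.mem_singleton]
  constructor
  · rintro ⟨-, h⟩
    have hm : StrictMono τ := fun i j hij => h i j hij (Nat.zero_le _) (Nat.zero_le _)
    have := (StrictMono.range_inj hm strictMono_id).mp (by simp [τ.surjective.range_eq])
    ext i
    simp [this]
  · rintro rfl
    refine ⟨?_, fun i j hij _ _ => hij⟩
    rintro ⟨a, b, c, hab, hbc, h1, h2⟩
    exact absurd (hab.trans h2) (lt_irrefl _)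

theorem BB_top (m : ℕ) : BB (m + 1) (m + 1) = BB (m + 1) m := by
  ext τ
  rw [mem_BB, mem_BB]
  refine ⟨fun h => ⟨h.1, fun i j hij h1 h2 => ?_⟩, InB_mono (Nat.le_succ m) τ⟩
  have hi := (τ i).isLt
  have hj := (τ j).isLt
  exact absurd (τ.injective (Fin.ext (by omega : (τ i : ℕ) = τ j))) hij.ne

theorem card_BB_succ (m k : ℕ) (hk : k < m) :
    (BB (m + 1) (k + 1)).card = (BB (m + 1) k).card + (BB m (k + 1)).card := by
  rw [← card_WW m k hk, ← card_WW_add (m + 1) k, add_comm]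

theorem card_BB_eq (m : ℕ) : ∀ k, k < m →
    (BB m (k + 1)).card + (m + k + 1).choose k = (m + k + 1).choose (k + 1) := by
  induction m with
  | zero => intro k hk; omega
  | succ m ih =>
    intro k
    induction k with
    | zero =>
      intro _
      by_cases hm : m = 0
      · subst hm
        rw [BB_top, card_BB_zero]; rfl
      · have h1 := ih 0 (by omega)
        rw [card_BB_succ m 0 (by omega), card_BB_zero]
        simp at h1 ⊢
        omega
    | succ k ihk =>
      intro hk
      have h2 := ihk (by omega)
      have e1 : m + 1 + (k + 1) + 1 = (m + k + 2) + 1 := by ring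
      have e2 : m + 1 + k + 1 = m + k + 2 := by ring
      rw [e1, Nat.choose_succ_succ (m + k + 2) k, Nat.choose_succ_succ (m + k + 2) (k + 1)]
      rw [e2] at h2
      by_cases hm : k + 1 = m
      · subst hm
        rw [BB_top]
        have e3 : (k + 1 + k + 2).choose (k + 1 + 1) = (k + 1 + k + 2).choose (k + 1) :=
          Nat.choose_symm_of_eq_add (by ring)
        simp only [Nat.succ_eq_add_one]
        omega
      · have h1 := ih (k + 1) (by omega)
        rw [card_BB_succ m (k + 1) (by omega)]
        have e4 : m + (k + 1) + 1 = m + k + 2 := by ring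
        rw [e4] at h1
        simp only [Nat.succ_eq_add_one]
        omega

theorem pos_iff {m k : ℕ} (hk : k < m) (τ : Equiv.Perm (Fin m)) (h : InB m (k + 1) τ) :
    k + 1 ≤ (τ⁻¹ ⟨k, hk⟩ : ℕ) ↔ ¬ InB m k τ := by
  set p := τ⁻¹ ⟨k, hk⟩ with hp
  have hτp : τ p = ⟨k, hk⟩ := by simp [hp]
  constructor
  · intro h1 h2
    have hsub : (Finset.Iio p).image τ ⊆ Finset.Iio ⟨k, hk⟩ := by
      intro x hx
      obtain ⟨i, hi, rfl⟩ := Finset.mem_image.mp hx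
      rw [Finset.mem_Iio] at hi ⊢
      by_contra hc
      have hc' : k ≤ (τ i : ℕ) := by rw [Fin.lt_def] at hc; simpa using hc
      have := h2.2 i p hi hc' (by rw [hτp])
      rw [hτp] at this
      simp at this; omega
    have := Finset.card_le_card hsub
    rw [Finset.card_image_of_injective _ τ.injective] at this
    simp at this
    omega
  · intro h2
    have h3 : ∃ i, i < p ∧ k < (τ i : ℕ) := by
      by_contra hc
      push Not at hc
      refine h2 ⟨h.1, fun i j hij hi hj => ?_⟩
      have hne : (τ i : ℕ) ≠ τ j := fun hh => hij.ne (τ.injective (Fin.ext hh))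
      by_cases hi' : k + 1 ≤ (τ i : ℕ)
      · by_cases hj' : k + 1 ≤ (τ j : ℕ)
        · exact h.2 i j hij hi' hj'
        · have : j = p := τ.injective (by rw [hτp]; exact Fin.ext (by simp; omega))
          have := hc i (this ▸ hij)
          omega
      · omega
    obtain ⟨i, hip, hi⟩ := h3
    have hsub : insert (τ i) (Finset.Iio ⟨k, hk⟩) ⊆ (Finset.Iio p).image τ := by
      intro x hx
      rw [Finset.mem_insert] at hx
      rcases hx with rfl | hx
      · exact Finset.mem_image_of_mem _ (Finset.mem_Iio.mpr hip)
      · rw [Finset.mem_Iio] at hx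
        refine Finset.mem_image.mpr ⟨τ⁻¹ x, ?_, by simp⟩
        rw [Finset.mem_Iio]
        by_contra hc
        have hne : τ⁻¹ x ≠ p := by
          intro hh
          have : x = ⟨k, hk⟩ := by rw [← hτp, ← hh]; simp
          exact hx.ne this
        refine h.1 ⟨i, p, τ⁻¹ x, hip, lt_of_le_of_ne (not_lt.mp hc) hne.symm, ?_, ?_⟩
        · rw [hτp]; simpa using hx
        · rw [hτp]; exact hi
    have := Finset.card_le_card hsub
    rw [Finset.card_image_of_injective _ τ.injective, Finset.card_insert_of_notMem] at this
    · simpa using this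
    · rw [Finset.mem_Iio, Fin.lt_def]; simp; omega

theorem App_inv {m : ℕ} (j : Fin (m + 1)) (τ : Equiv.Perm (Fin m)) (x : Fin m)
    (hx : (x : ℕ) < j) : (App j τ)⁻¹ ⟨x, by omega⟩ = (τ⁻¹ x).castSucc := by
  rw [Equiv.Perm.inv_eq_iff_eq]
  apply Fin.ext
  rw [App_val]
  simp [hx]

/-- the number of 321-avoiding `π ∈ Sₙ` with last entry `k+1` and
`π⁻¹(k) > k` is `C_{n-2,k} = ((n-k-1)/(n-1))·binom(n+k-2,k)` (all 1-based;
in 0-based terms the last entry is `k` and the position of the value `k-1`,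
plus one, exceeds `k`). -/
theorem stmt13 (n k : ℕ) (hn : 3 ≤ n) (hk1 : 1 ≤ k) (hk2 : k ≤ n - 2) :
    (((Finset.univ.filter fun π : Equiv.Perm (Fin n) =>
        avoids321 π ∧ (π ⟨n - 1, by omega⟩ : ℕ) = k ∧
          k < (π⁻¹ ⟨k - 1, by omega⟩ : ℕ) + 1)).card : ℚ) =
      ((n : ℚ) - (k : ℚ) - 1) / ((n : ℚ) - 1) * ((n + k - 2).choose k : ℚ) := by
  obtain ⟨m, rfl⟩ : ∃ m, n = m + 2 := ⟨n - 2, by omega⟩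
  obtain ⟨k, rfl⟩ : ∃ l, k = l + 1 := ⟨k - 1, by omega⟩
  have hkm : k < m := by omega
  have hk3 : k + 1 < m + 1 + 1 := by omega
  have hset : (Finset.univ.filter fun π : Equiv.Perm (Fin (m + 2)) =>
        avoids321 π ∧ (π ⟨m + 2 - 1, by omega⟩ : ℕ) = k + 1 ∧
          k + 1 < (π⁻¹ ⟨k + 1 - 1, by omega⟩ : ℕ) + 1) =
      (WW (m + 1) k).image (App (⟨k + 1, by omega⟩ : Fin (m + 2))) := by
    ext π
    have hl : (⟨m + 2 - 1, by omega⟩ : Fin (m + 2)) = Fin.last (m + 1) := rfl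
    have hval : ∀ τ : Equiv.Perm (Fin (m + 1)),
        (((App (⟨k + 1, by omega⟩ : Fin (m + 2)) τ)⁻¹ ⟨k + 1 - 1, by omega⟩ :
          Fin (m + 2)) : ℕ) = (τ⁻¹ ⟨k, by omega⟩ : ℕ) := by
      intro τ
      have := App_inv (⟨k + 1, by omega⟩ : Fin (m + 2)) τ ⟨k, by omega⟩ (by simp)
      exact congrArg Fin.val this
    simp only [Finset.mem_filter, Finset.mem_univ, true_and, Finset.mem_image, WW,
      Finset.mem_sdiff, mem_BB]
    rw [hl]
    constructor
    · rintro ⟨h1, h2, h3⟩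
      obtain ⟨τ, hτ⟩ := App_surj π
      have hj : π (Fin.last (m + 1)) = ⟨k + 1, hk3⟩ := Fin.ext h2
      rw [hj] at hτ
      clear hj h2
      subst hτ
      rw [avoids_App] at h1
      rw [hval] at h3
      exact ⟨τ, ⟨h1, (pos_iff (by omega) τ h1).mp (by omega)⟩, rfl⟩
    · rintro ⟨τ, ⟨h1, h2⟩, rfl⟩
      refine ⟨(avoids_App _ _).mpr h1, by rw [App_last], ?_⟩
      rw [hval]
      have := (pos_iff (by omega) τ h1).mpr h2
      omega
  have hcard : (Finset.univ.filter fun π : Equiv.Perm (Fin (m + 2)) =>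
        avoids321 π ∧ (π ⟨m + 2 - 1, by omega⟩ : ℕ) = k + 1 ∧
          k + 1 < (π⁻¹ ⟨k + 1 - 1, by omega⟩ : ℕ) + 1).card = (BB m (k + 1)).card := by
    rw [hset, Finset.card_image_of_injective _ (App_inj _), card_WW m k hkm]
  rw [hcard]
  have h1 := card_BB_eq m k hkm
  have h2 := Nat.choose_succ_right_eq (m + k + 1) k
  have e1 : m + k + 1 - k = m + 1 := by omega
  have e2 : m + 2 + (k + 1) - 2 = m + k + 1 := by omega
  rw [e1] at h2
  rw [e2]
  have h1' : ((BB m (k + 1)).card : ℚ) + ((m + k + 1).choose k : ℚ) =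
    ((m + k + 1).choose (k + 1) : ℚ) := by exact_mod_cast h1
  have h2' : ((m + k + 1).choose (k + 1) : ℚ) * (k + 1) =
    ((m + k + 1).choose k : ℚ) * (m + 1) := by exact_mod_cast h2
  have hm : (m : ℚ) + 1 ≠ 0 := by positivity
  have hm' : ((m + 2 : ℕ) : ℚ) - 1 = m + 1 := by push_cast; ring
  rw [hm']
  field_simp
  push_cast
  linear_combination (m + 1 : ℚ) * h1' + h2'
end

section
/- For all integers n ≥ 1, 0 ≤ k ≤ n, and every m ≥ 0, the number of permutations π ∈ S_{n+1}^k(321) with vnw(π) = m equals the number of sequences a ∈ Γ_{n,k} with vpk(a) = m. -/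
attribute [local instance] Classical.propDecidable

/-- Non-left-to-right-maximum positions. -/
def NLx {n : ℕ} (σ : Equiv.Perm (Fin n)) (j : Fin n) : Prop := ∃ i, i < j ∧ σ j < σ i

noncomputable def nlx {n : ℕ} (σ : Equiv.Perm (Fin n)) : ℕ :=
  (Finset.univ.filter fun j => NLx σ j).card

def insx {n : ℕ} (k : Fin (n + 1)) (σ : Equiv.Perm (Fin n)) : Equiv.Perm (Fin (n + 1)) :=
  ((finSuccEquiv' (Fin.last n)).trans (Equiv.optionCongr σ)).trans (finSuccEquiv' k).symm

lemma insx_last {n : ℕ} (k : Fin (n + 1)) (σ : Equiv.Perm (Fin n)) :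
    insx k σ (Fin.last n) = k := by
  simp [insx]

lemma insx_castSucc {n : ℕ} (k : Fin (n + 1)) (σ : Equiv.Perm (Fin n)) (i : Fin n) :
    insx k σ i.castSucc = k.succAbove (σ i) := by
  have := finSuccEquiv'_succAbove (Fin.last n) i
  rw [Fin.succAbove_last] at this
  simp [insx, this]

lemma insx_bij (n : ℕ) : Function.Bijective
    (fun p : Fin (n + 1) × Equiv.Perm (Fin n) => insx p.1 p.2) := by
  rw [Fintype.bijective_iff_injective_and_card]
  constructor
  · rintro ⟨k, σ⟩ ⟨k', σ'⟩ h
    simp only at h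
    have h1 : k = k' := by rw [← insx_last k σ, h, insx_last]
    subst h1
    have h2 : σ = σ' := by
      ext i
      have := insx_castSucc k σ i
      rw [h, insx_castSucc] at this
      rw [Fin.succAbove_right_injective this]
    rw [h2]
  · simp [Fintype.card_perm, Nat.factorial_succ]

lemma sum_perm_insx {n : ℕ} (f : Equiv.Perm (Fin (n + 1)) → ℕ) :
    ∑ π, f π = ∑ k, ∑ σ, f (insx k σ) := by
  rw [← Fintype.sum_prod_type' (f := fun k σ => f (insx k σ))]
  exact (Function.Bijective.sum_comp (insx_bij n) f).symm

lemma NLx_castSucc {n : ℕ} (k : Fin (n + 1)) (σ : Equiv.Perm (Fin n)) (j : Fin n) :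
    NLx (insx k σ) j.castSucc ↔ NLx σ j := by
  unfold NLx
  constructor
  · rintro ⟨i, hi, h⟩
    induction i using Fin.lastCases with
    | last => exact absurd hi (by simp [Fin.lt_def])
    | cast i =>
      rw [insx_castSucc, insx_castSucc, Fin.succAbove_lt_succAbove_iff] at h
      exact ⟨i, hi, h⟩
  · rintro ⟨i, hi, h⟩
    refine ⟨i.castSucc, hi, ?_⟩
    rw [insx_castSucc, insx_castSucc, Fin.succAbove_lt_succAbove_iff]
    exact h

lemma NLx_last {n : ℕ} (k : Fin (n + 1)) (σ : Equiv.Perm (Fin n)) :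
    NLx (insx k σ) (Fin.last n) ↔ (k : ℕ) < n := by
  unfold NLx
  rw [insx_last]
  constructor
  · rintro ⟨i, hi, h⟩
    have := (insx k σ i).2
    rw [Fin.lt_def] at h
    omega
  · intro h
    refine ⟨(insx k σ).symm (Fin.last n), ?_, ?_⟩
    · apply Fin.lt_last_iff_ne_last.2
      intro e
      have := insx_last k σ
      rw [← e, Equiv.apply_symm_apply] at this
      rw [← this] at h
      simp at h
    · simpa [Fin.lt_def] using h

lemma avoids_insx {n : ℕ} (k : Fin (n + 1)) (σ : Equiv.Perm (Fin n)) :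
    avoids321 (insx k σ) ↔ avoids321 σ ∧ ∀ j, NLx σ j → (σ j : ℕ) < k := by
  unfold avoids321
  constructor
  · intro h
    constructor
    · rintro ⟨i, j, l, h1, h2, h3, h4⟩
      apply h
      refine ⟨i.castSucc, j.castSucc, l.castSucc, h1, h2, ?_, ?_⟩ <;>
      · rw [insx_castSucc, insx_castSucc, Fin.succAbove_lt_succAbove_iff]
        assumption
    · rintro j ⟨i, hi, hj⟩
      by_contra hc
      apply h
      refine ⟨i.castSucc, j.castSucc, Fin.last n, hi, Fin.castSucc_lt_last j, ?_, ?_⟩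
      · rw [insx_last, insx_castSucc, Fin.lt_succAbove_iff_le_castSucc, Fin.le_def]
        simpa using hc
      · rw [insx_castSucc, insx_castSucc, Fin.succAbove_lt_succAbove_iff]
        assumption
  · rintro ⟨ha, hb⟩ ⟨i, j, l, h1, h2, h3, h4⟩
    induction j using Fin.lastCases with
    | last => exact absurd h2 (not_lt.2 (Fin.le_last l))
    | cast j =>
    induction i using Fin.lastCases with
    | last => exact absurd h1 (not_lt.2 (Fin.le_last _))
    | cast i =>
    rw [insx_castSucc, insx_castSucc, Fin.succAbove_lt_succAbove_iff] at h4
    induction l using Fin.lastCases with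
    | last =>
      rw [insx_last, insx_castSucc, Fin.lt_succAbove_iff_le_castSucc, Fin.le_def] at h3
      have := hb j ⟨i, h1, h4⟩
      simp at h3
      omega
    | cast l =>
      rw [insx_castSucc, insx_castSucc, Fin.succAbove_lt_succAbove_iff] at h3
      exact ha ⟨i, j, l, h1, h2, h3, h4⟩

lemma card_filter_castSucc {n : ℕ} (p : Fin (n + 1) → Prop) [DecidablePred p] :
    (Finset.univ.filter p).card =
      (Finset.univ.filter fun i : Fin n => p i.castSucc).card
        + if p (Fin.last n) then 1 else 0 := by
  rw [Finset.card_filter, Finset.card_filter, Fin.sum_univ_castSucc]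

lemma nlx_insx {n : ℕ} (k : Fin (n + 1)) (σ : Equiv.Perm (Fin n)) :
    nlx (insx k σ) = nlx σ + if (k : ℕ) < n then 1 else 0 := by
  unfold nlx
  rw [card_filter_castSucc]
  simp only [NLx_castSucc, NLx_last]

lemma NLx_iff {n : ℕ} (π : Equiv.Perm (Fin n)) (h : avoids321 π) (i : Fin n) :
    NLx π i ↔ (π i : ℕ) < i := by
  constructor
  · rintro ⟨j, hj, hji⟩
    have hsub : insert (π j) (Finset.Iio (π i)) ⊆ (Finset.Iio i).map π.toEmbedding := by
      intro v hv
      rw [Finset.mem_insert] at hv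
      rcases hv with rfl | hv
      · simp [hj]
      · rw [Finset.mem_Iio] at hv
        rw [Finset.mem_map_equiv, Finset.mem_Iio]
        by_contra hc
        rcases lt_or_eq_of_le (not_lt.1 hc) with h1 | h1
        · exact h ⟨j, i, π.symm v, hj, h1, by simpa using hv, hji⟩
        · rw [h1] at hv; simp at hv
    have := Finset.card_le_card hsub
    rw [Finset.card_insert_of_notMem (by simpa using hji.le), Finset.card_map] at this
    simp at this
    omega
  · intro hlt
    by_contra hc
    have hsub : (Finset.Iio i).map π.toEmbedding ⊆ Finset.Iio (π i) := by
      intro v hv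
      rw [Finset.mem_map_equiv, Finset.mem_Iio] at hv
      rw [Finset.mem_Iio]
      by_contra hc2
      rcases lt_or_eq_of_le (not_lt.1 hc2) with h1 | h1
      · exact hc ⟨π.symm v, hv, by simpa using h1⟩
      · rw [← h1] at hv; simp at hv
    have := Finset.card_le_card hsub
    rw [Finset.card_map] at this
    simp at this
    omega

lemma vnw_insx {n : ℕ} (k : Fin (n + 1)) (σ : Equiv.Perm (Fin n))
    (h : avoids321 (insx k σ)) : vnwStat (insx k σ) = nlx σ := by
  unfold vnwStat nlx
  rw [card_filter_castSucc]
  simp only [Fin.val_castSucc, Fin.val_last, lt_irrefl, false_and, if_false, add_zero]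
  congr 1
  ext i
  have h2 := NLx_iff _ h i.castSucc
  rw [NLx_castSucc, Fin.val_castSucc] at h2
  simp only [Finset.mem_filter, Finset.mem_univ, true_and]
  rw [h2]
  have := i.2
  constructor
  · exact fun x => x.2
  · exact fun x => ⟨by omega, x⟩

/-- 321-avoiding, and all values at non-left-to-right-maxima are below `k`. -/
def Okx {n : ℕ} (σ : Equiv.Perm (Fin n)) (k : ℕ) : Prop :=
  avoids321 σ ∧ ∀ j, NLx σ j → (σ j : ℕ) < k

lemma avoids_insx' {n : ℕ} (k : Fin (n + 1)) (σ : Equiv.Perm (Fin n)) :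
    avoids321 (insx k σ) ↔ Okx σ k := avoids_insx k σ

noncomputable def Qx (n k : ℕ) (w : ℕ → ℕ) : ℕ :=
  ∑ σ : Equiv.Perm (Fin n), if Okx σ k then w (nlx σ) else 0

lemma Qx_ge {n k : ℕ} (w : ℕ → ℕ) (h : n ≤ k) : Qx n k w = Qx n n w := by
  unfold Qx
  apply Finset.sum_congr rfl
  intro σ _
  have h1 : ∀ j, NLx σ j → (σ j : ℕ) < k := fun j _ => lt_of_lt_of_le (σ j).2 h
  have h2 : ∀ j, NLx σ j → (σ j : ℕ) < n := fun j _ => (σ j).2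
  have : Okx σ k ↔ Okx σ n := ⟨fun x => ⟨x.1, h2⟩, fun x => ⟨x.1, h1⟩⟩
  simp only [this]

lemma Okx_last {n : ℕ} (σ : Equiv.Perm (Fin n)) (K : ℕ) :
    Okx (insx (Fin.last n) σ) K ↔ Okx σ K := by
  unfold Okx
  rw [avoids_insx]
  have h1 : (∀ j, NLx σ j → (σ j : ℕ) < (Fin.last n : ℕ)) := fun j _ => (σ j).2
  have h2 : (∀ j, NLx (insx (Fin.last n) σ) j → (insx (Fin.last n) σ j : ℕ) < K) ↔
      ∀ j, NLx σ j → (σ j : ℕ) < K := by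
    rw [Fin.forall_fin_succ']
    simp [NLx_castSucc, NLx_last, insx_castSucc]
  rw [h2]
  exact ⟨fun x => ⟨x.1.1, x.2⟩, fun x => ⟨⟨x.1, h1⟩, x.2⟩⟩

lemma Okx_cast {n : ℕ} (k : Fin n) (σ : Equiv.Perm (Fin n)) (K : ℕ) :
    Okx (insx k.castSucc σ) K ↔ Okx σ k ∧ (k : ℕ) < K := by
  have hk : ((k.castSucc : Fin (n + 1)) : ℕ) < n := k.2
  conv_lhs => unfold Okx
  rw [avoids_insx', Fin.forall_fin_succ', NLx_last, insx_last]
  simp only [NLx_castSucc, insx_castSucc, Fin.val_castSucc]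
  constructor
  · exact fun h => ⟨h.1, h.2.2 hk⟩
  · refine fun h => ⟨h.1, fun j hj => ?_, fun _ => h.2⟩
    have h1 := h.1.2 j hj
    have h2 := h.2
    rw [Fin.succAbove_of_castSucc_lt k.castSucc (σ j) (Fin.lt_def.2 h1)]
    simp only [Fin.val_castSucc]
    omega

lemma Qx_succ (n K : ℕ) (w : ℕ → ℕ) :
    Qx (n + 1) K w = Qx n K w +
      ∑ k ∈ Finset.range n, if k < K then Qx n k (fun x => w (x + 1)) else 0 := by
  conv_lhs => unfold Qx
  rw [sum_perm_insx, Fin.sum_univ_castSucc, add_comm]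
  congr 1
  · unfold Qx
    apply Finset.sum_congr rfl
    intro σ _
    simp [nlx_insx, Okx_last]
  · rw [Finset.sum_range]
    apply Finset.sum_congr rfl
    intro k _
    unfold Qx
    by_cases hK : (k : ℕ) < K
    · simp [nlx_insx, Okx_cast, hK]
    · simp [Okx_cast, hK]

lemma lhs_eq (n k : ℕ) (hk : k ≤ n) (m : ℕ) :
    ((Finset.univ.filter fun π : Equiv.Perm (Fin (n + 1)) =>
        avoids321 π ∧ (π ⟨n, Nat.lt_succ_self n⟩ : ℕ) = k ∧ vnwStat π = m)).card =
    Qx n k (fun x => if x = m then 1 else 0) := by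
  rw [Finset.card_filter, sum_perm_insx, Finset.sum_eq_single (⟨k, by omega⟩ : Fin (n + 1))]
  · unfold Qx
    apply Finset.sum_congr rfl
    intro σ _
    have hl : insx (⟨k, by omega⟩ : Fin (n + 1)) σ ⟨n, Nat.lt_succ_self n⟩ = ⟨k, by omega⟩ :=
      insx_last _ _
    rw [hl]
    by_cases h : avoids321 (insx (⟨k, by omega⟩ : Fin (n + 1)) σ)
    · rw [vnw_insx _ _ h, if_pos ((avoids_insx' _ _).1 h)]
      simp [h]
    · rw [if_neg (fun x => h x.1), if_neg (fun x => h ((avoids_insx' _ _).2 x))]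
  · intro k' _ hne
    apply Finset.sum_eq_zero
    intro σ _
    apply if_neg
    rintro ⟨-, h, -⟩
    have hl : insx k' σ ⟨n, Nat.lt_succ_self n⟩ = k' := insx_last _ _
    rw [hl] at h
    exact hne (Fin.ext h)
  · simp

def pkx {N : ℕ} (a : Fin N → Bool) : ℕ :=
  (Finset.univ.filter fun i : Fin N =>
    a i = true ∧ ∃ j : Fin N, (j : ℕ) = (i : ℕ) + 1 ∧ a j = false).card

def tx {N : ℕ} (b : Bool) (a : Fin N → Bool) (m : ℕ) : ℕ :=
  (Finset.univ.filter fun i : Fin N => (i : ℕ) < m ∧ a i = b).card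

/-- append a letter -/
def snx {N : ℕ} (a : Fin N → Bool) (c : Bool) : Fin (N + 1) → Bool :=
  Fin.snoc (α := fun _ => Bool) a c

@[simp] lemma snx_castSucc {N : ℕ} (a : Fin N → Bool) (c : Bool) (i : Fin N) :
    snx a c i.castSucc = a i := by simp [snx]

@[simp] lemma snx_last {N : ℕ} (a : Fin N → Bool) (c : Bool) :
    snx a c (Fin.last N) = c := by simp [snx]

lemma sum_snx {N : ℕ} (f : (Fin (N + 1) → Bool) → ℕ) :
    ∑ a, f a = ∑ a, f (snx a false) + ∑ a, f (snx a true) := by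
  rw [← (Fin.snocEquiv (fun _ : Fin (N + 1) => Bool)).sum_comp, Fintype.sum_prod_type]
  simp [Fin.snocEquiv, snx, add_comm]

lemma tx_snx_le {N : ℕ} (a : Fin N → Bool) (b c : Bool) {m : ℕ} (h : m ≤ N) :
    tx b (snx a c) m = tx b a m := by
  unfold tx
  rw [card_filter_castSucc]
  simp [h]

lemma tx_snx_last {N : ℕ} (a : Fin N → Bool) (b c : Bool) :
    tx b (snx a c) (N + 1) = tx b a N + if c = b then 1 else 0 := by
  unfold tx
  rw [card_filter_castSucc]
  simp [Nat.lt_succ_of_lt]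

lemma tx_add {N : ℕ} (a : Fin N → Bool) : tx false a N + tx true a N = N := by
  unfold tx
  simp only [Fin.is_lt, true_and]
  have := Finset.card_filter_add_card_filter_not (s := (Finset.univ : Finset (Fin N)))
    (fun i => a i = false)
  simpa using this

def okx {N : ℕ} (n : ℕ) (a : Fin N → Bool) : Prop :=
  tx true a N = n ∧ ∀ m, m ≤ N → tx false a m ≤ tx true a m

lemma okx_false {N : ℕ} (n : ℕ) (a : Fin N → Bool) :
    okx n (snx a false) ↔ okx n a ∧ N + 1 ≤ 2 * n := by
  have h0 := tx_add a
  unfold okx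
  rw [tx_snx_last]
  constructor
  · rintro ⟨h1, h2⟩
    simp at h1
    refine ⟨⟨h1, fun m hm => ?_⟩, ?_⟩
    · have := h2 m (by omega)
      rwa [tx_snx_le _ _ _ hm, tx_snx_le _ _ _ hm] at this
    · have := h2 (N + 1) le_rfl
      rw [tx_snx_last, tx_snx_last] at this
      simp at this
      omega
  · rintro ⟨⟨h1, h2⟩, h3⟩
    refine ⟨by simpa using h1, fun m hm => ?_⟩
    rcases Nat.lt_or_ge N m with h | h
    · obtain rfl : m = N + 1 := by omega
      rw [tx_snx_last, tx_snx_last]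
      simp
      omega
    · rw [tx_snx_le _ _ _ h, tx_snx_le _ _ _ h]
      exact h2 m h

lemma okx_true {N : ℕ} (n : ℕ) (a : Fin N → Bool) :
    okx (n + 1) (snx a true) ↔ okx n a := by
  unfold okx
  rw [tx_snx_last]
  constructor
  · rintro ⟨h1, h2⟩
    simp at h1
    refine ⟨h1, fun m hm => ?_⟩
    have := h2 m (by omega)
    rwa [tx_snx_le _ _ _ hm, tx_snx_le _ _ _ hm] at this
  · rintro ⟨h1, h2⟩
    refine ⟨by simpa using h1, fun m hm => ?_⟩
    rcases Nat.lt_or_ge N m with h | h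
    · obtain rfl : m = N + 1 := by omega
      rw [tx_snx_last, tx_snx_last]
      have := h2 N le_rfl
      simp
      omega
    · rw [tx_snx_le _ _ _ h, tx_snx_le _ _ _ h]
      exact h2 m h

lemma okx_bound {N : ℕ} {n : ℕ} {a : Fin N → Bool} (h : okx n a) : n ≤ N ∧ N ≤ 2 * n := by
  have h0 := tx_add a
  have := h.2 N le_rfl
  have := h.1
  omega

lemma ex_next {N : ℕ} (a : Fin N → Bool) (c : Bool) (i : Fin N) :
    (∃ j : Fin (N + 1), (j : ℕ) = (i : ℕ) + 1 ∧ snx a c j = false) ↔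
      (∃ j : Fin N, (j : ℕ) = (i : ℕ) + 1 ∧ a j = false) ∨ (N = i + 1 ∧ c = false) := by
  rw [Fin.exists_fin_succ']
  simp

lemma ex_later {N : ℕ} (a : Fin N → Bool) (c : Bool) (i : Fin N) :
    (∃ j : Fin (N + 1), i.castSucc < j ∧ snx a c j = true) ↔
      (∃ j : Fin N, i < j ∧ a j = true) ∨ c = true := by
  rw [Fin.exists_fin_succ']
  simp [Fin.castSucc_lt_last]

lemma pkx_true {N : ℕ} (a : Fin N → Bool) : pkx (snx a true) = pkx a := by
  unfold pkx
  rw [card_filter_castSucc]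
  have : ∀ j : Fin (N + 1), (j : ℕ) ≠ N + 1 := fun j => by have := j.2; omega
  simp [ex_next, this]

lemma vpk_true {N : ℕ} (a : Fin N → Bool) : vpkStat (snx a true) = pkx a := by
  unfold pkx vpkStat
  rw [card_filter_castSucc]
  have : ∀ j : Fin (N + 1), (j : ℕ) ≠ N + 1 := fun j => by have := j.2; omega
  simp [ex_next, ex_later, this]

lemma vpk_false {N : ℕ} (a : Fin N → Bool) : vpkStat (snx a false) = vpkStat a := by
  unfold vpkStat
  rw [card_filter_castSucc]
  simp only [snx_last, snx_castSucc, Fin.val_castSucc, ex_next, ex_later]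
  simp only [Bool.false_eq_true, false_and, if_false, add_zero, or_false, and_true]
  congr 1
  ext i
  simp only [Finset.mem_filter, Finset.mem_univ, true_and]
  constructor
  · rintro ⟨h1, h2 | h2, j, h3, h4⟩
    · exact ⟨h1, h2, j, h3, h4⟩
    · have := j.2
      rw [Fin.lt_def] at h3
      omega
  · rintro ⟨h1, h2, h3⟩
    exact ⟨h1, Or.inl h2, h3⟩

lemma pkx_false {N : ℕ} (a : Fin N → Bool) (h : ∃ i, a i = true) :
    pkx (snx a false) = vpkStat a + 1 := by
  unfold vpkStat pkx
  rw [card_filter_castSucc]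
  simp only [snx_last, snx_castSucc, Fin.val_castSucc, ex_next]
  simp only [Bool.false_eq_true, false_and, if_false, add_zero, and_true]
  obtain ⟨i0, hi0⟩ := h
  have hne : (Finset.univ.filter fun i => a i = true).Nonempty := ⟨i0, by simp [hi0]⟩
  obtain ⟨r, hr, hmax⟩ := Finset.exists_max_image _ (fun i : Fin N => i) hne
  simp only [Finset.mem_filter, Finset.mem_univ, true_and] at hr hmax
  rw [← Finset.card_insert_of_notMem (a := r)]
  · congr 1
    ext i
    simp only [Finset.mem_filter, Finset.mem_univ, true_and, Finset.mem_insert]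
    constructor
    · rintro ⟨h1, h2⟩
      by_cases hir : i = r
      · exact Or.inl hir
      · have hlt : i < r := lt_of_le_of_ne (hmax i h1) hir
        refine Or.inr ⟨h1, ?_, r, hlt, hr⟩
        rcases h2 with h2 | h2
        · exact h2
        · have := r.2
          rw [Fin.lt_def] at hlt
          omega
    · rintro (rfl | ⟨h1, h2, h3⟩)
      · refine ⟨hr, ?_⟩
        by_cases hN : N = i + 1
        · exact Or.inr hN
        · have := i.2
          refine Or.inl ⟨⟨i + 1, by omega⟩, rfl, ?_⟩
          by_contra hc
          have := hmax _ (by simpa using hc)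
          rw [Fin.le_def] at this
          simp at this
      · exact ⟨h1, Or.inl h2⟩
  · simp only [Finset.mem_filter, Finset.mem_univ, true_and]
    rintro ⟨-, -, j, h1, h2⟩
    exact absurd (hmax j h2) (not_le.2 h1)

noncomputable def Fx (N n : ℕ) (w : ℕ → ℕ) : ℕ :=
  ∑ a : Fin N → Bool, if okx n a then w (vpkStat a) else 0

noncomputable def Gx (N n : ℕ) (w : ℕ → ℕ) : ℕ :=
  ∑ a : Fin N → Bool, if okx n a then w (pkx a) else 0

lemma Fx_zero {N n : ℕ} (w : ℕ → ℕ) (h : N < n ∨ 2 * n < N) : Fx N n w = 0 := by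
  apply Finset.sum_eq_zero
  intro a _
  apply if_neg
  intro h1
  have := okx_bound h1
  omega

lemma Gx_zero {N n : ℕ} (w : ℕ → ℕ) (h : N < n ∨ 2 * n < N) : Gx N n w = 0 := by
  apply Finset.sum_eq_zero
  intro a _
  apply if_neg
  intro h1
  have := okx_bound h1
  omega

lemma Fx_succ {M N n : ℕ} (w : ℕ → ℕ) (hM : M = N + 1) (h : N + 1 ≤ 2 * (n + 1)) :
    Fx M (n + 1) w = Fx N (n + 1) w + Gx N n w := by
  subst hM
  unfold Fx Gx
  rw [sum_snx]
  simp [okx_false, okx_true, vpk_false, vpk_true, h]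

lemma Gx_succ {M N n : ℕ} (w : ℕ → ℕ) (hM : M = N + 1) (h : N + 1 ≤ 2 * (n + 1)) :
    Gx M (n + 1) w = Fx N (n + 1) (fun x => w (x + 1)) + Gx N n w := by
  subst hM
  unfold Fx Gx
  rw [sum_snx]
  congr 1
  · apply Finset.sum_congr rfl
    intro a _
    by_cases hok : okx (n + 1) a
    · have : ∃ i, a i = true := by
        by_contra hc
        push Not at hc
        have := hok.1
        simp [tx, hc] at this
      simp [okx_false, hok, h, pkx_false a this]
    · simp [okx_false, hok]
  · simp [okx_true, pkx_true]

lemma Gx_diag (n : ℕ) (w : ℕ → ℕ) : Gx n n w = w 0 := by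
  induction n with
  | zero => simp [Gx, okx, tx, pkx]
  | succ n ih => rw [Gx_succ w rfl (by omega), Fx_zero _ (by omega), ih, zero_add]

lemma Fx_diag (n : ℕ) (w : ℕ → ℕ) : Fx n n w = w 0 := by
  cases n with
  | zero => simp [Fx, okx, tx, vpkStat]
  | succ n => rw [Fx_succ w rfl (by omega), Fx_zero _ (by omega), Gx_diag, zero_add]

lemma Fx_rec (n k : ℕ) (h : k ≤ n) (w : ℕ → ℕ) :
    Fx (n + 1 + k) (n + 1) w = Fx (n + k) n w +
      ∑ k' ∈ Finset.range k, Fx (n + k') n (fun x => w (x + 1)) := by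
  induction k with
  | zero => simp [Fx_diag]
  | succ k ih =>
    obtain ⟨n, rfl⟩ : ∃ n', n = n' + 1 := ⟨n - 1, by omega⟩
    rw [Finset.sum_range_succ, Fx_succ (N := n + 1 + 1 + k) w (by omega) (by omega),
      ih (by omega), Gx_succ (N := n + 1 + k) w (by omega) (by omega),
      Fx_succ (M := n + 1 + (k + 1)) (N := n + 1 + k) w (by omega) (by omega)]
    omega

lemma Fx_top (n : ℕ) (w : ℕ → ℕ) :
    Fx (n + 1 + (n + 1)) (n + 1) w = Fx (n + 1 + n) (n + 1) w := by
  rw [Fx_succ (N := n + 1 + n) w (by omega) (by omega), Gx_zero _ (by omega), add_zero]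

lemma Qx_eq_aux (n k : ℕ) (w : ℕ → ℕ) (h : k ≤ n)
    (ih : ∀ k w, k ≤ n → Qx n k w = Fx (n + k) n w) :
    Qx (n + 1) k w = Fx (n + 1 + k) (n + 1) w := by
  rw [Qx_succ, Fx_rec n k h, ih k w h, ← Finset.sum_filter]
  congr 1
  have : (Finset.range n).filter (fun x => x < k) = Finset.range k := by
    ext x
    simp
    omega
  rw [this]
  apply Finset.sum_congr rfl
  intro x hx
  rw [Finset.mem_range] at hx
  exact ih _ _ (by omega)

lemma Qx_eq (n : ℕ) : ∀ k w, k ≤ n → Qx n k w = Fx (n + k) n w := by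
  induction n with
  | zero =>
    intro k w hk
    obtain rfl : k = 0 := by omega
    rw [add_zero, Fx_diag]
    simp [Qx, Okx, avoids321, nlx]
  | succ n ih =>
    intro k w hk
    rcases Nat.lt_or_ge n k with h | h
    · obtain rfl : k = n + 1 := by omega
      have e : Qx (n + 1) (n + 1) w = Qx (n + 1) n w := by
        rw [Qx_succ, Qx_succ, Qx_ge w (Nat.le_succ n)]
        congr 1
        apply Finset.sum_congr rfl
        intro x hx
        rw [Finset.mem_range] at hx
        rw [if_pos hx, if_pos (by omega)]
      rw [e, Fx_top]
      exact Qx_eq_aux n n w le_rfl ih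
    · exact Qx_eq_aux n k w h ih

lemma mem_GammaBP (n k : ℕ) (a : Fin (n + k) → Bool) : a ∈ GammaBP n k ↔ okx n a := by
  unfold GammaBP okx tx
  simp [Nat.lt_succ_iff]

lemma rhs_eq (n k m : ℕ) :
    ((GammaBP n k).filter fun a => vpkStat a = m).card =
      Fx (n + k) n (fun x => if x = m then 1 else 0) := by
  unfold Fx
  rw [← Finset.sum_filter, Finset.card_filter]
  apply Finset.sum_congr
  · ext a
    simp [mem_GammaBP]
  · intro a _
    rfl

/-- `vnw` over `S_{n+1}^k(321)` is equidistributed with `vpk`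
over `Γ_{n,k}`. -/
theorem stmt15 (n k : ℕ) (hn : 1 ≤ n) (hk : k ≤ n) (m : ℕ) :
    ((Finset.univ.filter fun π : Equiv.Perm (Fin (n + 1)) =>
        avoids321 π ∧ (π ⟨n, Nat.lt_succ_self n⟩ : ℕ) = k ∧ vnwStat π = m)).card =
    ((GammaBP n k).filter fun a => vpkStat a = m).card := by
  rw [lhs_eq n k hk m, rhs_eq n k m]
  exact Qx_eq n k _ hk
end

section
/- For all integers n ≥ 1, 0 ≤ k ≤ n, and every m ≥ 0, the number of permutations π ∈ A_{n,k}(213) with des(π) = m equals the number of permutations σ ∈ S_{n+1}^k(321) with vnw(σ) = m. -/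
attribute [local instance] Classical.propDecidable

/-! ### Inserting a value at a position -/

noncomputable def insPerm {n : ℕ} (p v : Fin (n + 1)) (σ : Equiv.Perm (Fin n)) :
    Equiv.Perm (Fin (n + 1)) :=
  Equiv.ofBijective (Fin.insertNth (α := fun _ => Fin (n + 1)) p v (fun i => v.succAbove (σ i)))
    (by
      rw [← Finite.injective_iff_bijective]
      intro a b
      refine Fin.succAboveCases p ?_ (fun i => ?_) a <;>
      refine Fin.succAboveCases p ?_ (fun j => ?_) b
      · simp
      · simp only [Fin.insertNth_apply_same, Fin.insertNth_apply_succAbove]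
        intro h
        exact absurd h.symm (Fin.succAbove_ne _ _)
      · simp only [Fin.insertNth_apply_same, Fin.insertNth_apply_succAbove]
        intro h
        exact absurd h (Fin.succAbove_ne _ _)
      · simp only [Fin.insertNth_apply_succAbove]
        intro h
        rw [σ.injective (Fin.succAbove_right_injective h)])

@[simp] theorem insPerm_same {n : ℕ} (p v : Fin (n + 1)) (σ : Equiv.Perm (Fin n)) :
    insPerm p v σ p = v := by
  simp [insPerm]

@[simp] theorem insPerm_succAbove {n : ℕ} (p v : Fin (n + 1)) (σ : Equiv.Perm (Fin n))
    (i : Fin n) : insPerm p v σ (p.succAbove i) = v.succAbove (σ i) := by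
  simp [insPerm]

theorem insPerm_bijective {n : ℕ} (p : Fin (n + 1)) :
    Function.Bijective (fun x : Fin (n + 1) × Equiv.Perm (Fin n) => insPerm p x.1 x.2) := by
  rw [Fintype.bijective_iff_injective_and_card]
  constructor
  · rintro ⟨v, σ⟩ ⟨w, τ⟩ h
    simp only at h
    have h1 : v = w := by
      have := congrArg (fun e : Equiv.Perm (Fin (n + 1)) => e p) h
      simpa using this
    subst h1
    have h2 : σ = τ := by
      ext i
      have := congrArg (fun e : Equiv.Perm (Fin (n + 1)) => e (p.succAbove i)) h
      simp only [insPerm_succAbove] at this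
      rw [Fin.succAbove_right_injective this]
    rw [h2]
  · simp [Fintype.card_perm, Nat.factorial_succ]

theorem sum_insPerm {n : ℕ} (p : Fin (n + 1)) (F : Equiv.Perm (Fin (n + 1)) → ℕ) :
    ∑ σ, F σ = ∑ v : Fin (n + 1), ∑ σ : Equiv.Perm (Fin n), F (insPerm p v σ) := by
  rw [← (insPerm_bijective p).sum_comp F, Fintype.sum_prod_type]

theorem succAbove_lt_iff_nat {n : ℕ} (v : Fin (n + 1)) (i : Fin n) :
    ((v.succAbove i : Fin (n+1)) : ℕ) = if (i : ℕ) < v then (i : ℕ) else i + 1 := by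
  unfold Fin.succAbove
  split_ifs <;> simp_all [Fin.lt_def]

/-! ### The 321 side -/

def okV {n : ℕ} (k : ℕ) (σ : Equiv.Perm (Fin n)) : Prop :=
  ∀ i j : Fin n, i < j → k ≤ (σ j : ℕ) → σ i < σ j

noncomputable def stV {n : ℕ} (σ : Equiv.Perm (Fin n)) : ℕ :=
  (Finset.univ.filter fun i : Fin n => ∃ j, j < i ∧ σ i < σ j).card

noncomputable def cQ (N : ℕ) (k : ℕ) (m : ℤ) : ℕ :=
  ∑ σ : Equiv.Perm (Fin N), if avoids321 σ ∧ okV k σ ∧ (stV σ : ℤ) = m then 1 else 0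

theorem lt_iff_of_avoids321 {n : ℕ} (σ : Equiv.Perm (Fin n)) (h : avoids321 σ) (i : Fin n) :
    ((σ i : ℕ) < i) ↔ ∃ j, j < i ∧ σ i < σ j := by
  constructor
  · intro hi
    by_contra hc
    push Not at hc
    have : ((Finset.Iio i).image σ) ⊆ Finset.Iio (σ i) := by
      intro x hx
      simp only [Finset.mem_image, Finset.mem_Iio] at hx ⊢
      obtain ⟨j, hj, rfl⟩ := hx
      exact lt_of_le_of_ne (hc j hj) (fun e => hj.ne (σ.injective e))
    have := Finset.card_le_card this
    rw [Finset.card_image_of_injective _ σ.injective] at this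
    simp at this
    omega
  · rintro ⟨j, hj, hij⟩
    have : ((insert (σ j) (Finset.Iio (σ i))).image σ.symm) ⊆ Finset.Iio i := by
      intro x hx
      simp only [Finset.mem_image, Finset.mem_Iio, Finset.mem_insert] at hx ⊢
      obtain ⟨y, rfl | hy, rfl⟩ := hx
      · simpa using hj
      · by_contra hc
        refine h ⟨j, i, σ.symm y, hj, lt_of_le_of_ne (not_lt.1 hc) ?_, by simpa using hy, hij⟩
        rintro rfl
        simp at hy
    have := Finset.card_le_card this
    rw [Finset.card_image_of_injective _ σ.symm.injective,
      Finset.card_insert_of_notMem (by simp [hij.le])] at this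
    simp at this
    omega

theorem insLast_castSucc {n : ℕ} (v : Fin (n + 1)) (σ : Equiv.Perm (Fin n))
    (i : Fin n) : insPerm (Fin.last n) v σ i.castSucc = v.succAbove (σ i) := by
  have := insPerm_succAbove (Fin.last n) v σ i
  rwa [Fin.succAbove_last] at this

theorem avoids321_ins {n : ℕ} (v : Fin (n + 1)) (σ : Equiv.Perm (Fin n)) :
    avoids321 (insPerm (Fin.last n) v σ) ↔ avoids321 σ ∧ okV v σ := by
  constructor
  · intro h
    constructor
    · rintro ⟨i, j, l, h1, h2, h3, h4⟩
      refine h ⟨i.castSucc, j.castSucc, l.castSucc, by simpa, by simpa, ?_, ?_⟩ <;>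
        simpa [insLast_castSucc, Fin.succAbove_lt_succAbove_iff]
    · intro i j hij hv
      by_contra hc
      refine h ⟨i.castSucc, j.castSucc, Fin.last n, by simpa, Fin.castSucc_lt_last _, ?_, ?_⟩
      · rw [insPerm_same, insLast_castSucc, Fin.lt_def, succAbove_lt_iff_nat]
        split_ifs <;> omega
      · rw [insLast_castSucc, insLast_castSucc, Fin.succAbove_lt_succAbove_iff]
        exact lt_of_le_of_ne (not_lt.1 hc) (fun e => hij.ne' (σ.injective e))
  · rintro ⟨h1, h2⟩ ⟨i, j, l, hij, hjl, ha, hb⟩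
    induction j using Fin.lastCases with
    | last => exact absurd hjl (Fin.le_last _).not_gt
    | cast j =>
    induction i using Fin.lastCases with
    | last => exact absurd hij (Fin.le_last _).not_gt
    | cast i =>
    rw [insLast_castSucc, insLast_castSucc, Fin.succAbove_lt_succAbove_iff] at hb
    induction l using Fin.lastCases with
    | last =>
      rw [insPerm_same, insLast_castSucc, Fin.lt_def, succAbove_lt_iff_nat] at ha
      refine absurd (h2 i j (by simpa using hij) ?_) hb.le.not_gt
      split_ifs at ha <;> omega
    | cast l =>
      rw [insLast_castSucc, insLast_castSucc, Fin.succAbove_lt_succAbove_iff] at ha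
      exact h1 ⟨i, j, l, by simpa using hij, by simpa using hjl, ha, hb⟩

theorem exists_castSucc_lt {n : ℕ} (v : Fin (n + 1)) (σ : Equiv.Perm (Fin n)) (i : Fin n) :
    (∃ j, j < i.castSucc ∧ insPerm (Fin.last n) v σ i.castSucc < insPerm (Fin.last n) v σ j) ↔
    ∃ j, j < i ∧ σ i < σ j := by
  constructor
  · rintro ⟨j, hj, h⟩
    induction j using Fin.lastCases with
    | last => exact absurd hj (Fin.le_last _).not_gt
    | cast j =>
      rw [insLast_castSucc, insLast_castSucc, Fin.succAbove_lt_succAbove_iff] at h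
      exact ⟨j, by simpa using hj, h⟩
  · rintro ⟨j, hj, h⟩
    refine ⟨j.castSucc, by simpa, ?_⟩
    rwa [insLast_castSucc, insLast_castSucc, Fin.succAbove_lt_succAbove_iff]

theorem vnw_ins {n : ℕ} (v : Fin (n + 1)) (σ : Equiv.Perm (Fin n))
    (h : avoids321 (insPerm (Fin.last n) v σ)) :
    vnwStat (insPerm (Fin.last n) v σ) = stV σ := by
  unfold vnwStat stV
  rw [Finset.card_filter, Finset.card_filter, Fin.sum_univ_castSucc]
  simp only [lt_iff_of_avoids321 _ h, exists_castSucc_lt]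
  simp

theorem stV_ins {n : ℕ} (v : Fin (n + 1)) (σ : Equiv.Perm (Fin n)) :
    stV (insPerm (Fin.last n) v σ) = stV σ + if v = Fin.last n then 0 else 1 := by
  unfold stV
  rw [Finset.card_filter, Finset.card_filter, Fin.sum_univ_castSucc]
  simp only [exists_castSucc_lt]
  congr 1
  have : (∃ j, j < Fin.last n ∧ insPerm (Fin.last n) v σ (Fin.last n) <
      insPerm (Fin.last n) v σ j) ↔ ¬ v = Fin.last n := by
    rw [insPerm_same]
    constructor
    · rintro ⟨j, _, h⟩ rfl
      exact absurd h (Fin.le_last _).not_gt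
    · intro h
      have hv : (v : ℕ) < n := Fin.val_lt_last h
      refine ⟨(σ.symm ⟨v, hv⟩).castSucc, Fin.castSucc_lt_last _, ?_⟩
      rw [insLast_castSucc, Fin.lt_def, succAbove_lt_iff_nat]
      simp
  by_cases hv : v = Fin.last n
  · rw [if_neg (by rw [this]; simpa), if_pos hv]
  · rw [if_pos (this.2 hv), if_neg hv]

theorem okV_ins_last {n : ℕ} (k : ℕ) (σ : Equiv.Perm (Fin n)) :
    okV k (insPerm (Fin.last n) (Fin.last n) σ) ↔ okV k σ := by
  constructor
  · intro h i j hij hk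
    have := h i.castSucc j.castSucc (by simpa) (by simpa [insLast_castSucc] using hk)
    simpa [insLast_castSucc] using this
  · intro h i j hij hk
    induction i using Fin.lastCases with
    | last => exact absurd hij (Fin.le_last _).not_gt
    | cast i =>
    induction j using Fin.lastCases with
    | last => 
      rw [insPerm_same, insLast_castSucc, Fin.succAbove_last]
      exact Fin.castSucc_lt_last _
    | cast j =>
      have := h i j (by simpa using hij) (by simpa [insLast_castSucc] using hk)
      simpa [insLast_castSucc] using this

theorem okV_ins_castSucc {n : ℕ} (k : ℕ) (v : Fin n) (σ : Equiv.Perm (Fin n)) (hv : okV v σ) :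
    okV k (insPerm (Fin.last n) v.castSucc σ) ↔ (v : ℕ) < k := by
  constructor
  · intro h
    by_contra hc
    have := h (σ.symm v).castSucc (Fin.last n) (Fin.castSucc_lt_last _) (by simpa using hc)
    rw [insPerm_same, insLast_castSucc, Fin.lt_def, succAbove_lt_iff_nat] at this
    simp at this
  · intro h i j hij hk
    induction i using Fin.lastCases with
    | last => exact absurd hij (Fin.le_last _).not_gt
    | cast i =>
    induction j using Fin.lastCases with
    | last =>
      rw [insPerm_same] at hk
      simp at hk
      omega
    | cast j =>
      rw [insLast_castSucc, succAbove_lt_iff_nat] at hk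
      rw [insLast_castSucc, insLast_castSucc, Fin.succAbove_lt_succAbove_iff]
      refine hv i j (by simpa using hij) ?_
      simp at hk
      split_ifs at hk <;> omega

theorem cQ_zero (k : ℕ) (m : ℤ) : cQ 0 k m = if m = 0 then 1 else 0 := by
  unfold cQ
  rw [Fintype.sum_unique]
  have h1 : avoids321 (default : Equiv.Perm (Fin 0)) := by rintro ⟨i, _⟩; exact i.elim0
  have h2 : okV k (default : Equiv.Perm (Fin 0)) := fun i => i.elim0
  have h3 : stV (default : Equiv.Perm (Fin 0)) = 0 := by simp [stV]
  rw [h3]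
  by_cases hm : m = 0
  · rw [if_pos hm, if_pos ⟨h1, h2, by simp [hm]⟩]
  · rw [if_neg hm, if_neg]
    rintro ⟨_, _, h⟩
    exact hm (by simpa using h.symm)

theorem okV_of_le {n : ℕ} (k : ℕ) (h : n ≤ k) (σ : Equiv.Perm (Fin n)) : okV k σ := by
  intro i j _ hk
  have := (σ j).2
  omega

theorem cQ_succ (N k : ℕ) (m : ℤ) :
    cQ (N + 1) k m = cQ N k m + ∑ v : Fin N, if (v : ℕ) < k then cQ N v (m - 1) else 0 := by
  unfold cQ
  rw [sum_insPerm (Fin.last N), Fin.sum_univ_castSucc, add_comm]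
  congr 1
  · refine Finset.sum_congr rfl fun σ _ => ?_
    have : okV (Fin.last N : ℕ) σ := okV_of_le _ (by simp) σ
    simp only [avoids321_ins, okV_ins_last, stV_ins]
    refine if_congr ?_ rfl rfl
    simp only [this, and_true, if_true, add_zero]
  · refine Finset.sum_congr rfl fun v _ => ?_
    have key : ∀ σ : Equiv.Perm (Fin N),
        (avoids321 (insPerm (Fin.last N) v.castSucc σ) ∧ okV k (insPerm (Fin.last N) v.castSucc σ) ∧
          (stV (insPerm (Fin.last N) v.castSucc σ) : ℤ) = m) ↔
        ((v : ℕ) < k ∧ (avoids321 σ ∧ okV v σ ∧ (stV σ : ℤ) = m - 1)) := by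
      intro σ
      rw [avoids321_ins, stV_ins, if_neg (Fin.castSucc_lt_last v).ne]
      constructor
      · rintro ⟨⟨a, b⟩, c, d⟩
        exact ⟨(okV_ins_castSucc k v σ b).1 c, a, b, by push_cast at d; omega⟩
      · rintro ⟨c, a, b, d⟩
        exact ⟨⟨a, b⟩, (okV_ins_castSucc k v σ b).2 c, by push_cast; omega⟩
    simp only [key]
    split_ifs with hv <;> simp [hv]

theorem rhs_eq_s16 (n k m : ℕ) (hk : k ≤ n) :
    ((Finset.univ.filter fun σ : Equiv.Perm (Fin (n + 1)) =>
        avoids321 σ ∧ (σ ⟨n, Nat.lt_succ_self n⟩ : ℕ) = k ∧ vnwStat σ = m)).card = cQ n k m := by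
  rw [Finset.card_filter, sum_insPerm (Fin.last n)]
  have e : (⟨n, Nat.lt_succ_self n⟩ : Fin (n + 1)) = Fin.last n := rfl
  rw [Finset.sum_eq_single (⟨k, by omega⟩ : Fin (n + 1))]
  · unfold cQ
    refine Finset.sum_congr rfl fun σ _ => ?_
    refine if_congr ?_ rfl rfl
    rw [e, insPerm_same]
    constructor
    · rintro ⟨a, _, c⟩
      rw [vnw_ins _ _ a] at c
      obtain ⟨a1, a2⟩ := (avoids321_ins _ _).1 a
      exact ⟨a1, a2, by exact_mod_cast c⟩
    · rintro ⟨a1, a2, c⟩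
      have a := (avoids321_ins (⟨k, by omega⟩ : Fin (n + 1)) σ).2 ⟨a1, a2⟩
      refine ⟨a, rfl, ?_⟩
      rw [vnw_ins _ _ a]
      exact_mod_cast c
  · intro v _ hv
    refine Finset.sum_eq_zero fun σ _ => if_neg ?_
    rw [e, insPerm_same]
    rintro ⟨_, h, _⟩
    exact hv (Fin.ext h)
  · simp

/-! ### The recursion -/

def cH : ℕ → ℕ → ℤ → ℤ → ℕ
  | 0, _, k, m => if 0 ≤ k ∧ m = 0 then 1 else 0
  | N + 1, s, k, m => cH N 2 k m + (∑ j ∈ Finset.Ico 2 s, cH N (j + 1) (k - 1) m) +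
      cH N (s + 1) (k - 1) (m - 1)

theorem cH_neg (N : ℕ) : ∀ (s : ℕ) (k m : ℤ), k < 0 → cH N s k m = 0 := by
  induction N with
  | zero => intro s k m h; simp [cH]; omega
  | succ N ih =>
    intro s k m h
    simp only [cH]
    rw [ih _ _ _ h, ih _ _ _ (by omega), Finset.sum_eq_zero (fun j _ => ih _ _ _ (by omega)),
      add_zero, add_zero]

theorem cH_sat (N : ℕ) : ∀ (s : ℕ) (k m : ℤ), (N : ℤ) < k → cH N s k m = cH N s (k - 1) m := by
  induction N with
  | zero => intro s k m h; simp only [cH]; refine if_congr ?_ rfl rfl; simp at h; omega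
  | succ N ih =>
    intro s k m h
    push_cast at h
    simp only [cH]
    rw [ih 2 k m (by omega), ih (s + 1) (k - 1) (m - 1) (by omega)]
    congr 2
    refine Finset.sum_congr rfl fun j _ => ih _ _ _ (by omega)

theorem cH_diff (N : ℕ) : ∀ (s : ℕ) (k m : ℤ), 2 ≤ s → k ≤ N →
    cH N (s + 1) k m = cH N (s + 1) (k - 1) m + cH N s k m := by
  induction N with
  | zero =>
    intro s k m _ h
    simp only [cH]
    simp at h
    rw [if_neg (by omega : ¬ (0 ≤ k - 1 ∧ m = 0)), zero_add]
  | succ N ih =>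
    intro s k m hs h
    push_cast at h
    simp only [cH]
    have h1 : ∑ j ∈ Finset.Ico 2 (s + 1), cH N (j + 1) (k - 1) m =
        ∑ j ∈ Finset.Ico 2 (s + 1), cH N (j + 1) (k - 1 - 1) m +
        ∑ j ∈ Finset.Ico 2 (s + 1), cH N j (k - 1) m := by
      rw [← Finset.sum_add_distrib]
      refine Finset.sum_congr rfl fun j hj => ih _ _ _ (Finset.mem_Ico.1 hj).1 (by omega)
    have h2 : ∑ j ∈ Finset.Ico 2 (s + 1), cH N j (k - 1) m = cH N 2 (k - 1) m +
        ∑ j ∈ Finset.Ico 2 s, cH N (j + 1) (k - 1) m := by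
      rw [Finset.sum_eq_sum_Ico_succ_bot (by omega)]
      congr 1
      rw [Finset.sum_Ico_add' (fun j => cH N j (k - 1) m) 2 s 1]
    have h3 := ih (s + 1) (k - 1) (m - 1) (by omega) (by omega)
    omega

theorem cH_three (N k : ℕ) (m : ℤ) :
    cH N 3 ((k : ℤ) - 1) m = ∑ v : Fin (N + 1), if (v : ℕ) < k then cH N 2 (v : ℕ) m else 0 := by
  rw [Fin.sum_univ_eq_sum_range (fun v => if v < k then cH N 2 (v : ℕ) m else 0)]
  induction k with
  | zero => simp [cH_neg]
  | succ k ih =>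
    have : ∀ v : ℕ, (if v < k + 1 then cH N 2 (v : ℕ) m else 0) =
        (if v < k then cH N 2 (v : ℕ) m else 0) + (if v = k then cH N 2 (v : ℕ) m else 0) := by
      intro v
      split_ifs <;> omega
    simp only [this, Finset.sum_add_distrib, ← ih]
    rw [Finset.sum_ite_eq']
    push_cast
    rw [add_sub_cancel_right]
    split_ifs with hk
    · exact cH_diff N 2 k m le_rfl (by simp at hk; omega)
    · rw [add_zero]
      exact cH_sat N 3 k m (by simp at hk; omega)

theorem cQ_eq (N : ℕ) : ∀ (k : ℕ) (m : ℤ), cQ (N + 1) k m = cH N 2 k m := by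
  induction N with
  | zero => intro k m; rw [cQ_succ, cQ_zero]; simp [cH]
  | succ N ih =>
    intro k m
    rw [cQ_succ]
    simp only [ih]
    rw [← cH_three]
    simp [cH]

/-! ### The 213 side -/

noncomputable def sAl {n : ℕ} (π : Equiv.Perm (Fin n)) : Finset (Fin (n + 1)) :=
  Finset.univ.filter fun a => ∀ i j : Fin n, (π i : ℕ) < a → (a : ℕ) ≤ π j → j < i

def qSt {n : ℕ} (π : Equiv.Perm (Fin (n + 1))) : ℕ := n - (π (Fin.last n) : ℕ)

theorem maxdrop_le_iff {n : ℕ} (k : ℕ) (π : Equiv.Perm (Fin (n + 1))) (h : avoids213 π) :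
    maxdrop π ≤ k ↔ qSt π ≤ k := by
  unfold maxdrop qSt
  rw [Finset.sup_le_iff]
  constructor
  · intro h
    simpa using h (Fin.last n) (Finset.mem_univ _)
  · intro hk i _
    refine le_trans ?_ hk
    rcases le_or_gt (π (Fin.last n)) (π i) with hi | hi
    · have := i.2
      rw [Fin.le_def] at hi
      omega
    · have : ((Finset.Ioc (π i) (π (Fin.last n))).image π.symm) ⊆ Finset.Ioc i (Fin.last n) := by
        intro x hx
        simp only [Finset.mem_image, Finset.mem_Ioc] at hx ⊢
        obtain ⟨y, ⟨h1, h2⟩, rfl⟩ := hx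
        refine ⟨?_, Fin.le_last _⟩
        by_contra hc
        have hne : π.symm y ≠ i := by rintro rfl; simp at h1
        have hlt : π.symm y < i := lt_of_le_of_ne (not_lt.1 hc) hne
        have hil : i < Fin.last n := lt_of_le_of_ne (Fin.le_last _) (by rintro rfl; simp at hi)
        have hy : y ≠ π (Fin.last n) := by
          rintro rfl
          simp at hlt
          exact absurd hlt (Fin.le_last _).not_gt
        exact h ⟨π.symm y, i, Fin.last n, hlt, hil, by simpa using h1,
          by simpa using lt_of_le_of_ne h2 hy⟩
      have := Finset.card_le_card this
      rw [Finset.card_image_of_injective _ π.symm.injective] at this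
      simp at this
      have := i.2
      rw [Fin.lt_def] at hi
      omega

theorem insZero_succ {n : ℕ} (v : Fin (n + 1)) (σ : Equiv.Perm (Fin n))
    (i : Fin n) : insPerm 0 v σ i.succ = v.succAbove (σ i) := by
  have := insPerm_succAbove 0 v σ i
  rwa [Fin.succAbove_zero] at this

theorem avoids213_ins {n : ℕ} (a : Fin (n + 1)) (π : Equiv.Perm (Fin n)) :
    avoids213 (insPerm 0 a π) ↔ avoids213 π ∧ a ∈ sAl π := by
  simp only [sAl, Finset.mem_filter, Finset.mem_univ, true_and]
  constructor
  · intro h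
    constructor
    · rintro ⟨i, j, l, h1, h2, h3, h4⟩
      refine h ⟨i.succ, j.succ, l.succ, by simpa, by simpa, ?_, ?_⟩ <;>
        simpa [insZero_succ, Fin.succAbove_lt_succAbove_iff]
    · intro i j h1 h2
      by_contra hc
      have hne : i ≠ j := by rintro rfl; omega
      refine h ⟨0, i.succ, j.succ, Fin.succ_pos _, by
        simpa using lt_of_le_of_ne (not_lt.1 hc) hne, ?_, ?_⟩
      · rw [insPerm_same, insZero_succ, Fin.lt_def, succAbove_lt_iff_nat]
        split_ifs; omega
      · rw [insPerm_same, insZero_succ, Fin.lt_def, succAbove_lt_iff_nat]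
        split_ifs <;> omega
  · rintro ⟨h1, h2⟩ ⟨i, j, l, hij, hjl, ha, hb⟩
    induction j using Fin.cases with
    | zero => exact absurd hij (Fin.zero_le _).not_gt
    | succ j =>
    induction l using Fin.cases with
    | zero => exact absurd hjl (Fin.zero_le _).not_gt
    | succ l =>
    induction i using Fin.cases with
    | zero =>
      rw [insPerm_same, insZero_succ, Fin.lt_def, succAbove_lt_iff_nat] at ha hb
      refine absurd (h2 j l ?_ ?_) (by simpa using hjl.le)
      · split_ifs at ha <;> omega
      · split_ifs at hb <;> omega
    | succ i =>
      rw [insZero_succ, insZero_succ, Fin.succAbove_lt_succAbove_iff] at ha hb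
      exact h1 ⟨i, j, l, by simpa using hij, by simpa using hjl, ha, hb⟩

theorem zero_mem_sAl {n : ℕ} (π : Equiv.Perm (Fin n)) : (0 : Fin (n + 1)) ∈ sAl π := by
  simp [sAl]

theorem last_mem_sAl {n : ℕ} (π : Equiv.Perm (Fin n)) : Fin.last n ∈ sAl π := by
  simp only [sAl, Finset.mem_filter, Finset.mem_univ, true_and]
  intro i j _ h
  have := (π j).2
  simp at h
  omega

theorem sAl_ins {n : ℕ} (a : Fin (n + 1)) (π : Equiv.Perm (Fin n)) (ha : a ∈ sAl π) :
    sAl (insPerm 0 a π) =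
      insert (Fin.last (n + 1)) (((sAl π).filter (· ≤ a)).map Fin.castSuccEmb) := by
  ext b
  simp only [sAl, Finset.mem_filter, Finset.mem_univ, true_and, Finset.mem_insert,
    Finset.mem_map, Fin.coe_castSuccEmb] at ha ⊢
  induction b using Fin.lastCases with
  | last =>
    simp only [true_or, iff_true]
    intro i j _ h
    have := (insPerm 0 a π j).2
    simp at h
    omega
  | cast b =>
    have hb := b.2
    constructor
    · intro h
      right
      have hba : b ≤ a := by
        by_contra hc
        rw [not_le, Fin.lt_def] at hc
        obtain ⟨x, hx⟩ : ∃ x : Fin (n + 2), x = ⟨b, by omega⟩ := ⟨_, rfl⟩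
        have hx' : b.1 - 1 < n := by omega
        have := h 0 (π.symm ⟨b - 1, hx'⟩).succ (by simpa using hc) (by
          rw [insZero_succ, succAbove_lt_iff_nat]
          simp
          split_ifs <;> omega)
        exact absurd this (Fin.zero_le _).not_gt
      refine ⟨b, ⟨?_, hba⟩, rfl⟩
      intro i j h1 h2
      rw [Fin.le_def] at hba
      have := h i.succ j.succ (by
        rw [insZero_succ, succAbove_lt_iff_nat]; simp; split_ifs <;> omega) (by
        rw [insZero_succ, succAbove_lt_iff_nat]; simp; split_ifs <;> omega)
      simpa using this
    · rintro (h | ⟨c, ⟨h, hca⟩, hcb⟩)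
      · exact absurd h (Fin.castSucc_lt_last _).ne
      · have : c = b := by simpa using hcb
        subst this
        rw [Fin.le_def] at hca
        intro i j h1 h2
        induction i using Fin.cases with
        | zero => simp at h1; omega
        | succ i =>
        induction j using Fin.cases with
        | zero => exact Fin.succ_pos _
        | succ j =>
          rw [insZero_succ, succAbove_lt_iff_nat] at h1 h2
          simp only [Fin.val_castSucc] at h1 h2
          simp only [Fin.succ_lt_succ_iff]
          have h1' : (π i : ℕ) < c := by split_ifs at h1 <;> omega
          by_cases hj : (c : ℕ) ≤ π j
          · exact h i j h1' hj
          · split_ifs at h2 <;> omega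

theorem card_sAl_ins {n : ℕ} (a : Fin (n + 1)) (π : Equiv.Perm (Fin n)) (ha : a ∈ sAl π) :
    (sAl (insPerm 0 a π)).card = ((sAl π).filter (· ≤ a)).card + 1 := by
  rw [sAl_ins a π ha, Finset.card_insert_of_notMem, Finset.card_map]
  simp only [Finset.mem_map, Fin.coe_castSuccEmb, not_exists, not_and]
  intro x _ h
  exact absurd h (Fin.castSucc_lt_last _).ne

theorem qSt_ins {n : ℕ} (a : Fin (n + 2)) (π : Equiv.Perm (Fin (n + 1))) (ha : a ∈ sAl π) :
    qSt (insPerm 0 a π) = qSt π + if a = 0 then 0 else 1 := by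
  unfold qSt
  rw [← Fin.succ_last, insZero_succ, succAbove_lt_iff_nat]
  have hl := (π (Fin.last n)).2
  simp only [sAl, Finset.mem_filter, Finset.mem_univ, true_and] at ha
  by_cases h0 : a = 0
  · subst h0
    simp
  · rw [if_neg h0]
    have h1 : 0 < (a : ℕ) := Fin.pos_iff_ne_zero.2 h0
    have h2 : (π (Fin.last n) : ℕ) < a := by
      by_contra hc
      have := ha (π.symm 0) (Fin.last n) (by simpa using h1) (not_lt.1 hc)
      exact absurd this (Fin.le_last _).not_gt
    rw [if_pos h2]
    omega

theorem des_ins {n : ℕ} (a : Fin (n + 2)) (π : Equiv.Perm (Fin (n + 1))) (ha : a ∈ sAl π) :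
    desStat (insPerm 0 a π) = desStat π + if a = Fin.last (n + 1) then 1 else 0 := by
  unfold desStat
  rw [Finset.card_filter, Finset.card_filter, Fin.sum_univ_succ, add_comm]
  congr 1
  · refine Finset.sum_congr rfl fun i _ => if_congr ?_ rfl rfl
    constructor
    · rintro ⟨j, hj, h⟩
      induction j using Fin.cases with
      | zero => simp at hj
      | succ j =>
        rw [insZero_succ, insZero_succ, Fin.succAbove_lt_succAbove_iff] at h
        exact ⟨j, by simpa using hj, h⟩
    · rintro ⟨j, hj, h⟩
      refine ⟨j.succ, by simpa using hj, ?_⟩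
      rwa [insZero_succ, insZero_succ, Fin.succAbove_lt_succAbove_iff]
  · refine if_congr ?_ rfl rfl
    simp only [sAl, Finset.mem_filter, Finset.mem_univ, true_and] at ha
    constructor
    · rintro ⟨j, hj, h⟩
      have : j = Fin.succ 0 := by ext; simpa using hj
      subst this
      rw [insZero_succ, insPerm_same, Fin.lt_def, succAbove_lt_iff_nat] at h
      have h0 : (π 0 : ℕ) < a := by split_ifs at h <;> omega
      by_contra hc
      have hv : (a : ℕ) < n + 1 := Fin.val_lt_last hc
      have := ha 0 (π.symm ⟨a, hv⟩) h0 (by simp)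
      exact absurd this (Fin.zero_le _).not_gt
    · rintro rfl
      refine ⟨Fin.succ 0, by simp, ?_⟩
      rw [insZero_succ, insPerm_same, Fin.succAbove_last]
      exact Fin.castSucc_lt_last _

theorem sum_rank {N : ℕ} (S : Finset (Fin N)) (f : ℕ → ℕ) :
    ∑ a ∈ S, f ((S.filter (· ≤ a)).card) = ∑ j ∈ Finset.Ico 1 (S.card + 1), f j := by
  induction S using Finset.induction_on_max with
  | empty => simp
  | insert a S h ih =>
    have ha : a ∉ S := fun h' => lt_irrefl _ (h a h')
    rw [Finset.sum_insert ha, Finset.card_insert_of_notMem ha,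
      Finset.sum_Ico_succ_top (by omega), add_comm, ← ih]
    congr 1
    · refine Finset.sum_congr rfl fun x hx => ?_
      rw [Finset.filter_insert, if_neg (not_le.2 (h x hx))]
    · rw [Finset.filter_true_of_mem, Finset.card_insert_of_notMem ha]
      intro x hx
      rcases Finset.mem_insert.1 hx with rfl | hx
      · exact le_rfl
      · exact (h x hx).le

theorem sum_allowed {n : ℕ} (π : Equiv.Perm (Fin (n + 1))) (f : ℕ → ℕ → ℕ → ℕ) (q d : ℕ) :
    ∑ a ∈ sAl π, f (((sAl π).filter (· ≤ a)).card + 1) (q + if a = 0 then 0 else 1)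
      (d + if a = Fin.last (n + 1) then 1 else 0) =
    f 2 q d + (∑ j ∈ Finset.Ico 2 (sAl π).card, f (j + 1) (q + 1) d) +
      f ((sAl π).card + 1) (q + 1) (d + 1) := by
  have hcard : 2 ≤ (sAl π).card := by
    have : ({0, Fin.last (n + 1)} : Finset (Fin (n + 2))) ⊆ sAl π := by
      intro x hx
      simp only [Finset.mem_insert, Finset.mem_singleton] at hx
      rcases hx with rfl | rfl
      · exact zero_mem_sAl π
      · exact last_mem_sAl π
    have h2 := Finset.card_le_card this
    rwa [Finset.card_pair (Fin.last_pos).ne] at h2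
  have e0 : ∀ a ∈ sAl π, (a = 0 ↔ ((sAl π).filter (· ≤ a)).card = 1) := by
    intro a ha
    constructor
    · rintro rfl
      rw [Finset.card_eq_one]
      refine ⟨0, ?_⟩
      ext x
      simp only [Finset.mem_filter, Finset.mem_singleton, Fin.le_zero_iff]
      exact ⟨fun h => h.2, fun h => ⟨h ▸ zero_mem_sAl π, h⟩⟩
    · intro h
      obtain ⟨y, hy⟩ := Finset.card_eq_one.1 h
      have h1 : a ∈ (sAl π).filter (· ≤ a) := by simp [ha]
      have h2 : (0 : Fin (n + 2)) ∈ (sAl π).filter (· ≤ a) := by simp [zero_mem_sAl]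
      rw [hy, Finset.mem_singleton] at h1 h2
      rw [h1, h2]
  have e1 : ∀ a ∈ sAl π, (a = Fin.last (n + 1) ↔
      ((sAl π).filter (· ≤ a)).card = (sAl π).card) := by
    intro a ha
    constructor
    · rintro rfl
      rw [Finset.filter_true_of_mem]
      intro x _
      exact Fin.le_last _
    · intro h
      have := Finset.eq_of_subset_of_card_le (Finset.filter_subset (· ≤ a) (sAl π)) h.ge
      have h1 := last_mem_sAl π
      rw [← this, Finset.mem_filter] at h1
      exact Fin.last_le_iff.1 h1.2
  rw [Finset.sum_congr rfl (g := fun a => (fun c => f (c + 1) (q + if c = 1 then 0 else 1)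
      (d + if c = (sAl π).card then 1 else 0)) ((sAl π).filter (· ≤ a)).card)]
  · rw [sum_rank (sAl π) (fun c => f (c + 1) (q + if c = 1 then 0 else 1)
      (d + if c = (sAl π).card then 1 else 0)), Finset.sum_Ico_succ_top (by omega),
      Finset.sum_eq_sum_Ico_succ_bot (by omega)]
    congr 1
    · congr 1
      · rw [if_pos rfl, if_neg (by omega)]
        simp
      · refine Finset.sum_congr rfl fun j hj => ?_
        rw [Finset.mem_Ico] at hj
        rw [if_neg (by omega), if_neg (by omega)]
        simp
    · rw [if_neg (by omega), if_pos rfl]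
  · intro a ha
    simp only [e0 a ha, e1 a ha]

theorem sum_step {n : ℕ} (f : ℕ → ℕ → ℕ → ℕ) :
    (∑ π : Equiv.Perm (Fin (n + 2)),
      if avoids213 π then f (sAl π).card (qSt π) (desStat π) else 0) =
    ∑ π : Equiv.Perm (Fin (n + 1)), if avoids213 π then
      f 2 (qSt π) (desStat π) +
      (∑ j ∈ Finset.Ico 2 (sAl π).card, f (j + 1) (qSt π + 1) (desStat π)) +
      f ((sAl π).card + 1) (qSt π + 1) (desStat π + 1) else 0 := by
  rw [sum_insPerm 0, Finset.sum_comm]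
  refine Finset.sum_congr rfl fun π _ => ?_
  by_cases h : avoids213 π
  · rw [if_pos h, ← sum_allowed, ← Finset.sum_subset (Finset.subset_univ (sAl π))]
    · refine Finset.sum_congr rfl fun a ha => ?_
      rw [if_pos ((avoids213_ins a π).2 ⟨h, ha⟩), card_sAl_ins a π ha, qSt_ins a π ha,
        des_ins a π ha]
    · intro a _ ha
      exact if_neg fun hc => ha ((avoids213_ins a π).1 hc).2
  · rw [if_neg h]
    refine Finset.sum_eq_zero fun a _ => if_neg fun hc => h ((avoids213_ins a π).1 hc).1

theorem sum_cH (n : ℕ) : ∀ (N : ℕ) (k m : ℤ),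
    (∑ π : Equiv.Perm (Fin (n + 1)),
      if avoids213 π then cH N (sAl π).card (k - qSt π) (m - desStat π) else 0) =
    cH (n + N) 2 k m := by
  induction n with
  | zero =>
    intro N k m
    letI : Unique (Equiv.Perm (Fin (0 + 1))) := inferInstanceAs (Unique (Equiv.Perm (Fin 1)))
    rw [Fintype.sum_unique]
    have h1 : avoids213 (default : Equiv.Perm (Fin (0 + 1))) := by
      rintro ⟨i, j, l, h, _⟩
      omega
    have h2 : (sAl (default : Equiv.Perm (Fin (0 + 1)))).card = 2 := by
      have : sAl (default : Equiv.Perm (Fin (0 + 1))) = Finset.univ := by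
        ext x
        simp only [sAl, Finset.mem_filter, Finset.mem_univ, true_and, iff_true]
        intro i j h h'
        have : i = j := Fin.ext (by omega)
        subst this
        omega
      rw [this]
      simp
    have h3 : qSt (default : Equiv.Perm (Fin (0 + 1))) = 0 := by
      unfold qSt
      omega
    have h4 : desStat (default : Equiv.Perm (Fin (0 + 1))) = 0 := by
      unfold desStat
      rw [Finset.card_eq_zero, Finset.filter_eq_empty_iff]
      rintro i _ ⟨j, hj, _⟩
      omega
    rw [if_pos h1, h2, h3, h4]
    simp
  | succ n ih =>
    intro N k m
    rw [sum_step (fun s q d => cH N s (k - q) (m - d)), show n + 1 + N = n + (N + 1) by omega,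
      ← ih]
    refine Finset.sum_congr rfl fun π _ => if_congr Iff.rfl ?_ rfl
    simp only [cH]
    push_cast
    simp only [sub_sub]

theorem lhs_eq_s16 (n k m : ℕ) :
    ((bddA (n + 1) k).filter fun π => avoids213 π ∧ desStat π = m).card = cH n 2 k m := by
  unfold bddA
  rw [Finset.filter_filter, Finset.card_filter]
  have := sum_cH n 0 k m
  rw [add_zero] at this
  rw [← this]
  refine Finset.sum_congr rfl fun π _ => ?_
  by_cases h : avoids213 π
  · rw [if_pos h]
    simp only [cH]
    refine if_congr ?_ rfl rfl
    rw [maxdrop_le_iff k π h]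
    constructor
    · rintro ⟨a, _, b⟩
      omega
    · rintro ⟨a, b⟩
      exact ⟨by omega, h, by omega⟩
  · rw [if_neg h, if_neg]
    rintro ⟨_, h', _⟩
    exact h h'

/-- `des` over `A_{n,k}(213)` is equidistributed with `vnw` over
`S_{n+1}^k(321)`. -/
theorem stmt16 (n k : ℕ) (hn : 1 ≤ n) (hk : k ≤ n) (m : ℕ) :
    ((bddA n k).filter fun π => avoids213 π ∧ desStat π = m).card =
    ((Finset.univ.filter fun σ : Equiv.Perm (Fin (n + 1)) =>
        avoids321 σ ∧ (σ ⟨n, Nat.lt_succ_self n⟩ : ℕ) = k ∧ vnwStat σ = m)).card := by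
  obtain ⟨n, rfl⟩ : ∃ n', n = n' + 1 := ⟨n - 1, by omega⟩
  rw [rhs_eq_s16 (n + 1) k m hk, cQ_eq, lhs_eq_s16]
end

section
/- For every 213-avoiding permutation π ∈ S_n with n ≥ 1, one has des(π) = rmax(π) − 1, where rmax(π) is the number of right-to-left maxima of π. -/
attribute [local instance] Classical.propDecidable

/-- for a 213-avoiding permutation, `des π = rmax π - 1`. -/
theorem stmt17 (n : ℕ) (hn : 1 ≤ n) (π : Equiv.Perm (Fin n)) (h : avoids213 π) :
    desStat π = rmaxStat π - 1 := by
  have hlast : (⟨n - 1, by omega⟩ : Fin n) ∈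
      Finset.univ.filter (fun i : Fin n => ∀ j, i < j → π j < π i) := by
    simp only [Finset.mem_filter, Finset.mem_univ, true_and]
    intro j hj
    have h1 : n - 1 < (j : ℕ) := hj
    have h2 := j.isLt
    omega
  unfold desStat rmaxStat
  rw [← Finset.card_erase_of_mem hlast]
  congr 1
  ext i
  simp only [Finset.mem_filter, Finset.mem_univ, true_and, Finset.mem_erase]
  constructor
  · rintro ⟨j, hj, hd⟩
    refine ⟨?_, ?_⟩
    · intro he
      have h1 : (i : ℕ) = n - 1 := congrArg Fin.val he
      have h2 := j.isLt
      omega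
    · intro l hl
      by_contra hc
      have hl' : (i : ℕ) < l := hl
      have hne : π i ≠ π l := fun e => (ne_of_lt hl) (π.injective e)
      have hlt : π i < π l := lt_of_le_of_ne (not_lt.mp hc) hne
      have hjl : j ≠ l := by
        rintro rfl
        exact hc hd
      have hjl' : (j : ℕ) ≠ l := fun e => hjl (Fin.ext e)
      refine h ⟨i, j, l, ?_, ?_, hd, hlt⟩
      · rw [Fin.lt_def]; omega
      · rw [Fin.lt_def]; omega
  · rintro ⟨hne, hr⟩
    have h1 : (i : ℕ) ≠ n - 1 := fun e => hne (Fin.ext e)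
    have h2 := i.isLt
    refine ⟨⟨(i : ℕ) + 1, by omega⟩, rfl, hr _ ?_⟩
    rw [Fin.lt_def]
    exact Nat.lt_succ_self _
end
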